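/- Let N ≥ 3 be an integer, k an odd positive integer, l = k·2^N, and let m ≥ 2N+1 be an integer with m ≡ 2 (mod 4); set n = m + l and assume n ≥ 18. Then, in ℚ[c_1,…,c_n], B̂_n/n ≡ c_1^l·(B̂_m/m) + (l + l/(2mn))·c_1^n + l·(c_1^{n−9}c_3^3 + c_1^{n−18}c_3^6 + c_1^{n−5}c_2c_3 + c_1^{n−8}c_2c_3^2) − (l/2)·c_1^{n−3}c_3 + (3l/4)·c_1^{n−6}c_3^2 + θ·c_1^{n−12}c_3^4 (mod 2^{N+1}ℤ_2[c_1,…,c_n]), where θ = −l/2 if N = 3 and θ = l/2 if N ≥ 4. -/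

import Mathlib

open Finsupp MvPolynomial

noncomputable section

/-- weight of a partition (given as the multiplicity function of its parts) -/
def wt (u : ℕ →₀ ℕ) : ℕ := u.sum fun i m => i * m

/-- degree (number of parts) -/
def deg (u : ℕ →₀ ℕ) : ℕ := u.sum fun _ m => m

/-- γ_u = Π_i (i+1)^{u_i} (u_i)! -/
def gam (u : ℕ →₀ ℕ) : ℕ := u.prod fun i m => (i + 1) ^ m * m.factorial

/-- τ_u = (−1)^{d(u)−1} (w(u)+d(u)−2)! / γ_u -/
def tau (u : ℕ →₀ ℕ) : ℚ :=
  (-1 : ℚ) ^ (deg u - 1) * (Nat.factorial (wt u + deg u - 2) : ℚ) / (gam u : ℚ)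

/-- p-adic valuation on ℚ with v_p(0) = ⊤ -/
def pval (p : ℕ) (x : ℚ) : WithTop ℤ :=
  if x = 0 then ⊤ else ((padicValRat p x : ℤ) : WithTop ℤ)

/-- divided universal Bernoulli number B̂_n/n = Σ_{w(u)=n} τ_u c^u, as a
multivariate polynomial in the variables c_1, c_2, … (variable i is c_i). -/
def divB (n : ℕ) : MvPolynomial ℕ ℚ :=
  ∑ P : n.Partition, (tau P.parts.toFinsupp) • MvPolynomial.monomial P.parts.toFinsupp (1 : ℚ)

/-- F ≡ G (mod p^t ℤ_p[c_1,…]) : every coefficient of F − G has v_p ≥ t -/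
def PCong (p t : ℕ) (F G : MvPolynomial ℕ ℚ) : Prop :=
  ∀ u : ℕ →₀ ℕ, ((t : ℤ) : WithTop ℤ) ≤ pval p (MvPolynomial.coeff u (F - G))

/-- `x ∈ 2 ^ t ℤ_(2)`, where `ℤ_(2)` is the localization of `ℤ` at `2`. -/
def TwoDvd (t : ℕ) (x : ℚ) : Prop := ∃ a b : ℤ, Odd b ∧ x * b = 2 ^ t * a

namespace TwoDvd

variable {s t : ℕ} {x y : ℚ}

lemma zero (t : ℕ) : TwoDvd t 0 := ⟨0, 1, odd_one, by simp⟩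

lemma add (hx : TwoDvd t x) (hy : TwoDvd t y) : TwoDvd t (x + y) := by
  obtain ⟨a, b, hb, h⟩ := hx
  obtain ⟨c, d, hd, h'⟩ := hy
  refine ⟨a * d + c * b, b * d, hb.mul hd, ?_⟩
  push_cast
  linear_combination (d : ℚ) * h + (b : ℚ) * h'

lemma neg (hx : TwoDvd t x) : TwoDvd t (-x) := by
  obtain ⟨a, b, hb, h⟩ := hx
  refine ⟨-a, b, hb, ?_⟩
  push_cast
  linear_combination -h

lemma sub (hx : TwoDvd t x) (hy : TwoDvd t y) : TwoDvd t (x - y) := by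
  rw [sub_eq_add_neg]
  exact hx.add hy.neg

lemma mul (hx : TwoDvd s x) (hy : TwoDvd t y) : TwoDvd (s + t) (x * y) := by
  obtain ⟨a, b, hb, h⟩ := hx
  obtain ⟨c, d, hd, h'⟩ := hy
  refine ⟨a * c, b * d, hb.mul hd, ?_⟩
  push_cast
  rw [pow_add]
  linear_combination (y * d) * h + (2 ^ s * a : ℚ) * h'

lemma mono (hx : TwoDvd t x) (hst : s ≤ t) : TwoDvd s x := by
  obtain ⟨a, b, hb, h⟩ := hx
  refine ⟨2 ^ (t - s) * a, b, hb, ?_⟩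
  rw [h, ← Nat.add_sub_cancel' hst, pow_add]
  push_cast
  simp only [Nat.add_sub_cancel_left]
  ring

lemma of_dvd {z : ℤ} (h : (2 : ℤ) ^ t ∣ z) : TwoDvd t (z : ℚ) := by
  obtain ⟨c, rfl⟩ := h
  exact ⟨c, 1, odd_one, by push_cast; ring⟩

lemma int (z : ℤ) : TwoDvd 0 (z : ℚ) := of_dvd (by simp)

lemma nat (z : ℕ) : TwoDvd 0 (z : ℚ) := by exact_mod_cast int z

lemma sum {ι : Type*} {S : Finset ι} {f : ι → ℚ} (h : ∀ i ∈ S, TwoDvd t (f i)) :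
    TwoDvd t (∑ i ∈ S, f i) := by
  classical
  induction S using Finset.induction_on with
  | empty => simpa using zero t
  | insert a S ha ih =>
    rw [Finset.sum_insert ha]
    exact (h a (Finset.mem_insert_self a S)).add
      (ih fun i hi => h i (Finset.mem_insert_of_mem hi))

lemma le_pval (h : TwoDvd t x) : ((t : ℤ) : WithTop ℤ) ≤ pval 2 x := by
  unfold pval
  split_ifs with hx
  · exact le_top
  · obtain ⟨a, b, hb, h⟩ := h
    have hb0 : (b : ℚ) ≠ 0 := by
      rintro h0
      have : b = 0 := by exact_mod_cast h0
      simp [this] at hb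
    have ha0 : (a : ℚ) ≠ 0 := by
      rintro h0
      rw [h0, mul_zero] at h
      exact (mul_ne_zero hx hb0) h
    have e := congrArg (padicValRat 2) h
    rw [padicValRat.mul hx hb0, padicValRat.mul (by positivity) ha0,
      padicValRat.pow, padicValRat.of_int, padicValRat.of_int] at e
    have e2 : padicValRat 2 (2 : ℚ) = 1 := by
      simpa using padicValRat.self (p := 2) one_lt_two
    have e3 : padicValInt 2 b = 0 := by
      rw [padicValInt.eq_zero_iff]
      right; right
      have := Int.odd_iff.mp hb
      push_cast
      omega
    rw [e2, e3] at e
    have : (t : ℤ) ≤ padicValRat 2 x := by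
      push_cast at e
      have : (0 : ℤ) ≤ padicValInt 2 a := by positivity
      linarith
    exact_mod_cast this

end TwoDvd

/-- The product of the `l` consecutive odd integers starting from `2 * y + 1`. -/
def oddProd (y : ℤ) (l : ℕ) : ℤ := ∏ j ∈ Finset.range l, (2 * (y + j) + 1)

lemma oddProd_add (y : ℤ) (a b : ℕ) : oddProd y (a + b) = oddProd y a * oddProd (y + a) b := by
  unfold oddProd
  rw [Finset.prod_range_add]
  congr 1
  refine Finset.prod_congr rfl fun j _ => ?_
  push_cast
  ring

lemma odd_oddProd (y : ℤ) (l : ℕ) : Odd (oddProd y l) := by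
  induction l with
  | zero => simp [oddProd]
  | succ l ih =>
    rw [oddProd, Finset.prod_range_succ]
    exact ih.mul ⟨_, rfl⟩

lemma oddProd_eight (y : ℤ) : ∃ c, oddProd y 8 = 1 + 16 * (1 + y ^ 2) + 64 * c := by
  have h : ∀ z : ZMod 64, (2 * z + 1) * (2 * (z + 1) + 1) * (2 * (z + 2) + 1) *
      (2 * (z + 3) + 1) * (2 * (z + 4) + 1) * (2 * (z + 5) + 1) * (2 * (z + 6) + 1) *
      (2 * (z + 7) + 1) = 1 + 16 * (1 + z ^ 2) := by decide
  have h' : ((oddProd y 8 : ℤ) : ZMod 64) = ((1 + 16 * (1 + y ^ 2) : ℤ) : ZMod 64) := by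
    have := h (y : ZMod 64)
    simp only [oddProd, Finset.prod_range_succ, Finset.prod_range_zero]
    push_cast
    rw [← this]
    ring
  rw [ZMod.intCast_eq_intCast_iff_dvd_sub] at h'
  obtain ⟨c, hc⟩ := h'
  exact ⟨-c, by push_cast at hc; linarith⟩

lemma oddProd_two_pow (N : ℕ) (hN : 3 ≤ N) :
    (∃ (a : ℤ) (P : Polynomial ℤ), ∀ y, oddProd y (2 ^ N) = a + 16 * P.eval y) ∧
    ∀ y, ∃ c, oddProd y (2 ^ N) = 1 + 2 ^ (N + 1) * (1 + y ^ 2) + 2 ^ (N + 3) * c := by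
  induction N, hN using Nat.le_induction with
  | base =>
    refine ⟨⟨105 ^ 2, ?_⟩, ?_⟩
    · let t : Polynomial ℤ := Polynomial.X ^ 2 + 4 * Polynomial.X
      let t' : Polynomial ℤ := t + 8 * Polynomial.X + 32
      refine ⟨16 * t ^ 2 * t' ^ 2 + 88 * t ^ 2 * t' + 105 * t ^ 2 + 88 * t * t' ^ 2 +
        484 * t * t' + 105 * t' ^ 2 + 1155 * t + 4620 * (Polynomial.X + 4), fun y => ?_⟩
      simp only [oddProd, t', t]
      norm_num [Finset.prod_range_succ]
      ring
    · intro y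
      simpa using oddProd_eight y
  | succ N hN ih =>
    obtain ⟨⟨a, P, hP⟩, hc⟩ := ih
    have step : ∀ y, oddProd y (2 ^ (N + 1)) =
        oddProd y (2 ^ N) * oddProd (y + 2 ^ N) (2 ^ N) := by
      intro y
      rw [pow_succ, mul_two, oddProd_add]
      push_cast
      rfl
    refine ⟨⟨a ^ 2, Polynomial.C a * (P + P.comp (Polynomial.X + Polynomial.C (2 ^ N))) +
      16 * P * P.comp (Polynomial.X + Polynomial.C (2 ^ N)), fun y => ?_⟩, fun y => ?_⟩
    · rw [step, hP, hP]
      simp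
      ring
    · obtain ⟨c, hc⟩ := hc y
      obtain ⟨d, hd⟩ := Polynomial.sub_dvd_eval_sub (y + 2 ^ N) y P
      have e : oddProd (y + 2 ^ N) (2 ^ N) = oddProd y (2 ^ N) + 2 ^ (N + 4) * d := by
        rw [hP, hP]
        rw [add_sub_cancel_left] at hd
        rw [pow_add]
        linear_combination 16 * hd
      rw [step, e]
      obtain ⟨M, rfl⟩ := Nat.exists_eq_add_of_le hN
      refine ⟨c + oddProd y (2 ^ (3 + M)) * d + 2 ^ (M + 1) * (1 + y ^ 2 + 4 * c) ^ 2, ?_⟩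
      generalize oddProd y (2 ^ (3 + M)) = A at *
      have hA : A * A = (1 + 2 ^ (3 + M + 1) * (1 + y ^ 2) + 2 ^ (3 + M + 3) * c) ^ 2 := by
        rw [hc]; ring
      linear_combination hA

lemma oddProd_modEq (N k : ℕ) (hN : 3 ≤ N) (y : ℤ) :
    ∃ c, oddProd y (k * 2 ^ N) =
      1 + 2 * ((k * 2 ^ N : ℕ) : ℤ) * (1 + y ^ 2) + 2 ^ (N + 3) * c := by
  induction k with
  | zero => exact ⟨0, by simp [oddProd]⟩
  | succ k ih =>
    obtain ⟨c, hc⟩ := ih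
    obtain ⟨d, hd⟩ := (oddProd_two_pow N hN).2 (y + (k * 2 ^ N : ℕ))
    rw [add_mul, one_mul, oddProd_add, hd, hc]
    obtain ⟨M, rfl⟩ := Nat.exists_eq_add_of_le hN
    push_cast
    refine ⟨d + c * (1 + 2 ^ (3 + M + 1) * (1 + (y + k * 2 ^ (3 + M)) ^ 2) +
      2 ^ (3 + M + 3) * d) + 2 * 2 ^ M * k * (2 * y + k * 2 ^ (3 + M)) +
      k * (1 + y ^ 2) * (4 * 2 ^ M * (1 + (y + k * 2 ^ (3 + M)) ^ 2) + 16 * 2 ^ M * d), ?_⟩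
    ring
lemma factorial_two_mul_eq (a : ℕ) :
    ((2 * a).factorial : ℤ) = oddProd 0 a * 2 ^ a * a.factorial := by
  induction a with
  | zero => simp [oddProd]
  | succ a ih =>
    rw [show 2 * (a + 1) = 2 * a + 1 + 1 by ring, Nat.factorial_succ, Nat.factorial_succ,
      Nat.factorial_succ, oddProd_add]
    push_cast
    rw [ih]
    simp [oddProd]
    ring

lemma factorial_two_mul_add_one_eq (a : ℕ) :
    ((2 * a + 1).factorial : ℤ) = oddProd 0 (a + 1) * 2 ^ a * a.factorial := by
  rw [Nat.factorial_succ, oddProd_add]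
  push_cast
  rw [factorial_two_mul_eq]
  simp [oddProd]
  ring

lemma oddProd_zero_modEq_one (r : ℕ) : oddProd 0 (4 * r + 1) ≡ 1 [ZMOD 16] := by
  induction r with
  | zero => simp [oddProd]
  | succ r ih =>
    rw [show 4 * (r + 1) + 1 = (4 * r + 1) + 4 by ring, oddProd_add]
    have h : oddProd (0 + (4 * r + 1 : ℕ)) 4 ≡ 1 [ZMOD 16] := by
      have h : ∀ z : ZMod 16, (8 * z + 3) * (8 * z + 5) * (8 * z + 7) * (8 * z + 9) = 1 := by
        decide
      refine (ZMod.intCast_eq_intCast_iff _ _ 16).mp ?_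
      have := h (r : ZMod 16)
      simp only [oddProd, Finset.prod_range_succ, Finset.prod_range_zero]
      push_cast
      refine Eq.trans ?_ this
      ring
    simpa using ih.mul h

/-- The weight of the partition obtained by adding `1` to every part. -/
def shWt (v : ℕ →₀ ℕ) : ℕ := wt v + deg v

lemma shWt_eq (v : ℕ →₀ ℕ) : shWt v = v.sum fun i a => (i + 1) * a := by
  simp only [shWt, wt, deg, Finsupp.sum, ← Finset.sum_add_distrib]
  exact Finset.sum_congr rfl fun i _ => by simp [add_mul]

/-- The constant factor in `tau_single_add`. -/
def cofactor (v : ℕ →₀ ℕ) : ℚ :=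
  2 ^ (shWt v / 2 - 1) * ((shWt v / 2 - 1).factorial : ℚ) / gam v

lemma gam_pos (v : ℕ →₀ ℕ) : 0 < gam v :=
  Finset.prod_pos fun _ _ => by positivity

section

variable {v : ℕ →₀ ℕ}

lemma disjoint_single_one (hv : v 1 = 0) (x : ℕ) :
    Disjoint (Finsupp.single 1 x).support v.support := by
  refine Finset.disjoint_of_subset_left Finsupp.support_single_subset ?_
  simp [hv]

lemma wt_single_add (x : ℕ) : wt (Finsupp.single 1 x + v) = x + wt v := by
  rw [wt, Finsupp.sum_add_index' (by simp) fun _ _ _ => mul_add _ _ _]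
  simp [wt]

lemma deg_single_add (x : ℕ) : deg (Finsupp.single 1 x + v) = x + deg v := by
  rw [deg, Finsupp.sum_add_index' (by simp) fun _ _ _ => rfl]
  simp [deg]

lemma gam_single_add (hv : v 1 = 0) (x : ℕ) :
    gam (Finsupp.single 1 x + v) = 2 ^ x * x.factorial * gam v := by
  rw [gam, Finsupp.prod_add_index_of_disjoint (disjoint_single_one hv x),
    Finsupp.prod_single_index (by simp), gam]

lemma three_le_shWt (hv0 : v 0 = 0) (hv : v 1 = 0) (hne : v ≠ 0) : 3 ≤ shWt v := by
  obtain ⟨i, hi⟩ := Finsupp.ne_iff.mp hne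
  rw [shWt_eq]
  have h2 : 2 ≤ i := by
    by_contra h
    interval_cases i <;> simp_all
  have h1 : 1 ≤ v i := Nat.one_le_iff_ne_zero.mpr hi
  calc 3 ≤ (i + 1) * v i := by nlinarith
    _ ≤ _ := Finset.single_le_sum (f := fun i => (i + 1) * v i) (fun _ _ => Nat.zero_le _)
      (Finsupp.mem_support_iff.mpr hi)

lemma factorial_shWt_sub_two (x h h' W : ℕ)
    (hW : W = 2 * h + 2 ∧ h' = h ∨ W = 2 * h + 3 ∧ h' = h + 1) :
    ((2 * x + W - 2).factorial : ℤ) =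
      oddProd 0 (x + h') * ((x + h).choose h * (2 ^ h * h.factorial)) * (2 ^ x * x.factorial) := by
  have e : ((x + h).factorial : ℤ) = (x + h).choose h * h.factorial * x.factorial := by
    rw [← Nat.choose_mul_factorial_mul_factorial (Nat.le_add_left h x), Nat.add_sub_cancel]
    push_cast
    ring
  rcases hW with ⟨rfl, rfl⟩ | ⟨rfl, rfl⟩
  · rw [show 2 * x + (2 * h' + 2) - 2 = 2 * (x + h') by omega, factorial_two_mul_eq, e]
    ring
  · rw [show 2 * x + (2 * h + 3) - 2 = 2 * (x + h) + 1 by omega, factorial_two_mul_add_one_eq, e,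
      add_assoc]
    ring

lemma tau_single_add (hv : v 1 = 0) (hW : 2 ≤ shWt v) (x : ℕ) :
    tau (Finsupp.single 1 x + v) = (-1) ^ (x + deg v - 1) *
      (oddProd 0 (x + ((shWt v + 1) / 2 - 1)) *
        (x + (shWt v / 2 - 1)).choose (shWt v / 2 - 1) * cofactor v) := by
  have h := factorial_shWt_sub_two x (shWt v / 2 - 1) ((shWt v + 1) / 2 - 1) (shWt v) (by omega)
  rw [tau, wt_single_add, deg_single_add, gam_single_add hv, cofactor,
    show x + wt v + (x + deg v) - 2 = 2 * x + shWt v - 2 by rw [shWt]; omega]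
  have h' : ((2 * x + shWt v - 2).factorial : ℚ) = ((2 * x + shWt v - 2).factorial : ℤ) := by
    norm_cast
  rw [h', h]
  have := gam_pos v
  have : (gam v : ℚ) ≠ 0 := by positivity
  push_cast
  field_simp

/-- The `2`-adic valuation of `∏ i, i! ^ (v i)`. -/
def valParts (v : ℕ →₀ ℕ) : ℕ := v.sum fun i a => padicValNat 2 i.factorial * a

lemma le_two_mul_val (i : ℕ) : i ≤ 2 * padicValNat 2 i.factorial + 1 := by
  have h : 2 ^ (i / 2) ∣ i.factorial := by
    have h1 : (2 : ℤ) ^ (i / 2) ∣ ((2 * (i / 2)).factorial : ℤ) := by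
      rw [factorial_two_mul_eq]
      exact (Dvd.intro_left _ rfl).mul_right _
    exact (by exact_mod_cast h1 : 2 ^ (i / 2) ∣ (2 * (i / 2)).factorial).trans
      (Nat.factorial_dvd_factorial (by omega))
  have := (padicValNat_dvd_iff_le (Nat.factorial_ne_zero i)).mp h
  omega

lemma one_le_val (i : ℕ) (hi : 2 ≤ i) : 1 ≤ padicValNat 2 i.factorial := by
  refine (padicValNat_dvd_iff_le (Nat.factorial_ne_zero i)).mp ?_
  simpa using Nat.dvd_factorial two_pos hi

lemma two_le_of_mem (hv0 : v 0 = 0) (hv : v 1 = 0) {i : ℕ} (hi : i ∈ v.support) : 2 ≤ i := by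
  rw [Finsupp.mem_support_iff] at hi
  by_contra h
  interval_cases i <;> simp_all

lemma shWt_le (hv0 : v 0 = 0) (hv : v 1 = 0) : shWt v ≤ 4 * valParts v := by
  rw [shWt_eq, valParts, Finsupp.sum, Finsupp.sum, Finset.mul_sum]
  refine Finset.sum_le_sum fun i hi => ?_
  have h1 := le_two_mul_val i
  have h2 := one_le_val i (two_le_of_mem hv0 hv hi)
  rw [← mul_assoc]
  exact Nat.mul_le_mul_right _ (by omega)

lemma wt_le : wt v ≤ 2 * valParts v + deg v := by
  rw [wt, deg, valParts, Finsupp.sum, Finsupp.sum, Finsupp.sum, Finset.mul_sum,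
    ← Finset.sum_add_distrib]
  refine Finset.sum_le_sum fun i _ => ?_
  have h1 := le_two_mul_val i
  nlinarith

lemma two_pow_valParts_mul_gam_dvd : 2 ^ valParts v * gam v ∣ (shWt v).factorial := by
  rw [shWt_eq]
  refine Dvd.dvd.trans ?_ (Nat.prod_factorial_dvd_factorial_sum v.support _)
  rw [valParts, gam, Finsupp.sum, Finsupp.prod, ← Finset.prod_pow_eq_pow_sum,
    ← Finset.prod_mul_distrib]
  refine Finset.prod_dvd_prod_of_dvd _ _ fun i _ => ?_
  have h := Nat.uniformBell_mul_eq (v i) (n := i + 1) (by omega)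
  change _ ∣ ((i + 1) * v i).factorial
  rw [mul_comm (i + 1) (v i), ← h, Nat.factorial_succ, mul_pow, pow_mul]
  have h2 : (2 ^ padicValNat 2 i.factorial) ^ v i ∣ i.factorial ^ v i :=
    pow_dvd_pow_of_dvd pow_padicValNat_dvd _
  calc _ ∣ i.factorial ^ v i * ((i + 1) ^ v i * (v i).factorial) := Nat.mul_dvd_mul_right h2 _
    _ ∣ _ := Dvd.intro_left ((v i).uniformBell (i + 1)) (by ring)

lemma exists_two_pow_le (n : ℕ) (hn : 2 ≤ n) :
    ∃ c b : ℕ, n * (n - 1) = 2 ^ c * b ∧ Odd b ∧ 2 ^ c ≤ n := by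
  rcases Nat.even_or_odd n with h | h
  · obtain ⟨c, b, hb, e⟩ := Nat.exists_eq_two_pow_mul_odd (n := n) (by omega)
    refine ⟨c, b * (n - 1), by rw [← mul_assoc, ← e], hb.mul ?_, ?_⟩
    · exact Nat.Even.sub_odd (by omega) h odd_one
    · exact Nat.le_of_dvd (by omega) (Dvd.intro _ e.symm)
  · obtain ⟨c, b, hb, e⟩ := Nat.exists_eq_two_pow_mul_odd (n := n - 1) (by omega)
    refine ⟨c, n * b, ?_, h.mul hb, ?_⟩
    · rw [← mul_assoc, mul_comm (2 ^ c), mul_assoc, ← e]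
    · exact (Nat.le_of_dvd (by omega) (Dvd.intro _ e.symm)).trans (Nat.sub_le _ _)

lemma twoDvd_cofactor (hW : 2 ≤ shWt v) :
    ∃ c, 2 ^ c ≤ shWt v ∧ (c ≤ valParts v → TwoDvd (valParts v - c) (cofactor v)) := by
  obtain ⟨c, b, hcb, hb, hc⟩ := exists_two_pow_le (shWt v) hW
  refine ⟨c, hc, fun hcg => ?_⟩
  obtain ⟨d, hd⟩ := two_pow_valParts_mul_gam_dvd (v := v)
  have h := factorial_shWt_sub_two 0 (shWt v / 2 - 1) ((shWt v + 1) / 2 - 1) (shWt v) (by omega)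
  rw [show 2 * 0 + shWt v - 2 = shWt v - 2 by omega] at h
  simp only [zero_add, Nat.choose_self, Nat.cast_one, one_mul, pow_zero, Nat.factorial_zero,
    mul_one] at h
  have hf : (shWt v).factorial = shWt v * (shWt v - 1) * (shWt v - 2).factorial := by
    obtain ⟨w, hw⟩ := Nat.exists_eq_add_of_le' hW
    rw [hw, Nat.factorial_succ, Nat.factorial_succ, ← mul_assoc]
    rfl
  rw [hf, hcb] at hd
  have hd' : (2 : ℚ) ^ c * b * (oddProd 0 ((shWt v + 1) / 2 - 1) *
      (2 ^ (shWt v / 2 - 1) * (shWt v / 2 - 1).factorial)) = 2 ^ valParts v * gam v * d := by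
    have : ((2 ^ c * b * (shWt v - 2).factorial : ℕ) : ℤ) = (2 ^ valParts v * gam v * d : ℕ) := by
      exact_mod_cast hd
    push_cast at this
    rw [h] at this
    exact_mod_cast this
  have hg := gam_pos v
  have hg' : (gam v : ℚ) ≠ 0 := by positivity
  refine ⟨d, b * oddProd 0 ((shWt v + 1) / 2 - 1),
    (by exact_mod_cast hb : Odd (b : ℤ)).mul (odd_oddProd _ _), ?_⟩
  rw [cofactor]
  rw [← Nat.add_sub_cancel' hcg, pow_add] at hd'
  have h2 : (2 : ℚ) ^ c ≠ 0 := by positivity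
  push_cast
  rw [div_mul_eq_mul_div, div_eq_iff hg']
  apply mul_left_cancel₀ h2
  linear_combination hd'

end
/-- A decidable form of the statement that `cofactor` is highly divisible by `2`, for a partition
with shifted weight `W`, with `gam = G` and `valParts = g`. The second number is odd. -/
def CofactorBound (W G g : ℕ) : Prop :=
  ∃ V < 10, W / 2 - 1 < 2 ^ V ∧ (g = 9 → 5 ≤ V) ∧
    2 ^ V * G ∣ 2 ^ (W / 2 - 1) * (W / 2 - 1).factorial * 10395 ^ 15

instance (W G g : ℕ) : Decidable (CofactorBound W G g) := by
  unfold CofactorBound; infer_instance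

/-- `CofactorBound` for the partition with multiplicities `a, b, …, s` of `2, 3, …, 11`, unless
this partition is exceptional. -/
def CofactorBoundOrExceptional (a b c d e f p q r s : ℕ) : Prop :=
  CofactorBound
      (3 * a + 4 * b + 5 * c + 6 * d + 7 * e + 8 * f + 9 * p + 10 * q + 11 * r + 12 * s)
      ((3 ^ a * a.factorial) * (4 ^ b * b.factorial) * (5 ^ c * c.factorial) *
        (6 ^ d * d.factorial) * (7 ^ e * e.factorial) * (8 ^ f * f.factorial) *
        (9 ^ p * p.factorial) * (10 ^ q * q.factorial) * (11 ^ r * r.factorial) *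
        (12 ^ s * s.factorial))
      (a + b + 3 * c + 3 * d + 4 * e + 4 * f + 7 * p + 7 * q + 8 * r + 8 * s) ∨
    (p = 0 ∧ q = 0 ∧ r = 0 ∧ s = 0 ∧ c = 0 ∧ d = 0 ∧ e = 0) ∧
      (a = 0 ∧ f = 1 ∧ b = 0 ∨ a = 0 ∧ f = 0 ∧ b ∈ [0, 1, 2, 3, 4, 5, 6, 8] ∨
        a = 1 ∧ f = 0 ∧ (b = 1 ∨ b = 2))

instance (a b c d e f p q r s : ℕ) : Decidable (CofactorBoundOrExceptional a b c d e f p q r s) := by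
  unfold CofactorBoundOrExceptional; infer_instance

/-- `CofactorBoundOrExceptional` for all partitions with given multiplicities of `2, …, 6`. -/
def CofactorBoundOrExceptionalTail (a b c d e : ℕ) : Prop :=
  ∀ f < (9 - a - b - 3 * c - 3 * d - 4 * e) / 4 + 1,
  ∀ p < (9 - a - b - 3 * c - 3 * d - 4 * e - 4 * f) / 7 + 1,
  ∀ q < (9 - a - b - 3 * c - 3 * d - 4 * e - 4 * f - 7 * p) / 7 + 1,
  ∀ r < (9 - a - b - 3 * c - 3 * d - 4 * e - 4 * f - 7 * p - 7 * q) / 8 + 1,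
  ∀ s < (9 - a - b - 3 * c - 3 * d - 4 * e - 4 * f - 7 * p - 7 * q - 8 * r) / 8 + 1,
    CofactorBoundOrExceptional a b c d e f p q r s

instance (a b c d e : ℕ) : Decidable (CofactorBoundOrExceptionalTail a b c d e) := by
  unfold CofactorBoundOrExceptionalTail; infer_instance

lemma cofactorBoundOrExceptional_enum : ∀ a < 10, ∀ b < 10 - a, ∀ c < (9 - a - b) / 3 + 1,
    ∀ d < (9 - a - b - 3 * c) / 3 + 1, ∀ e < (9 - a - b - 3 * c - 3 * d) / 4 + 1,
    CofactorBoundOrExceptionalTail a b c d e := by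
  decide +kernel

section

variable {v : ℕ →₀ ℕ}

lemma support_subset_of_valParts_le (hv0 : v 0 = 0) (hv : v 1 = 0) (hg : valParts v ≤ 9) :
    v.support ⊆ Finset.Ico 2 12 := by
  intro i hi
  rw [Finset.mem_Ico]
  refine ⟨two_le_of_mem hv0 hv hi, ?_⟩
  by_contra h
  have h1 : padicValNat 2 i.factorial * v i ≤ valParts v :=
    Finset.single_le_sum (f := fun i => padicValNat 2 i.factorial * v i) (fun _ _ => Nat.zero_le _)
      hi
  have h2 : 10 ≤ padicValNat 2 i.factorial := by
    refine (padicValNat_dvd_iff_le (Nat.factorial_ne_zero i)).mp ?_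
    exact (by decide : 2 ^ 10 ∣ (12).factorial).trans (Nat.factorial_dvd_factorial (by omega))
  have h3 := Nat.one_le_iff_ne_zero.mpr (Finsupp.mem_support_iff.mp hi)
  nlinarith

/-- The partitions whose coefficient needs a separate treatment. -/
def IsExceptional (v : ℕ →₀ ℕ) : Prop :=
  v = Finsupp.single 7 1 ∨ (∃ b ∈ [0, 1, 2, 3, 4, 5, 6, 8], v = Finsupp.single 3 b) ∨
    ∃ b, (b = 1 ∨ b = 2) ∧ v = Finsupp.single 2 1 + Finsupp.single 3 b

lemma eq_single_add_single_add_single (h : ∀ i, i ≠ 2 → i ≠ 3 → i ≠ 7 → v i = 0) :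
    v = Finsupp.single 2 (v 2) + Finsupp.single 3 (v 3) + Finsupp.single 7 (v 7) := by
  ext i
  simp only [Finsupp.add_apply]
  rcases eq_or_ne i 2 with rfl | h2
  · simp
  rcases eq_or_ne i 3 with rfl | h3
  · simp
  rcases eq_or_ne i 7 with rfl | h7
  · simp
  rw [h i h2 h3 h7, Finsupp.single_eq_of_ne h2, Finsupp.single_eq_of_ne h3,
    Finsupp.single_eq_of_ne h7, add_zero, add_zero]

lemma padicValNat_two_factorial_values :
    padicValNat 2 (Nat.factorial 2) = 1 ∧ padicValNat 2 (Nat.factorial 3) = 1 ∧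
    padicValNat 2 (Nat.factorial 4) = 3 ∧ padicValNat 2 (Nat.factorial 5) = 3 ∧
    padicValNat 2 (Nat.factorial 6) = 4 ∧ padicValNat 2 (Nat.factorial 7) = 4 ∧
    padicValNat 2 (Nat.factorial 8) = 7 ∧ padicValNat 2 (Nat.factorial 9) = 7 ∧
    padicValNat 2 (Nat.factorial 10) = 8 ∧ padicValNat 2 (Nat.factorial 11) = 8 := by
  have key : ∀ n k b : ℕ, n = 2 ^ k * b → b % 2 = 1 → padicValNat 2 n = k := by
    rintro _ k b rfl hb
    have hb0 : b ≠ 0 := by rintro rfl; simp at hb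
    rw [padicValNat.mul (by positivity) hb0, padicValNat.prime_pow,
      padicValNat.eq_zero_of_not_dvd (by omega), add_zero]
  exact ⟨key _ _ 1 (by decide) (by decide), key _ _ 3 (by decide) (by decide),
    key _ _ 3 (by decide) (by decide), key _ _ 15 (by decide) (by decide),
    key _ _ 45 (by decide) (by decide), key _ _ 315 (by decide) (by decide),
    key _ _ 315 (by decide) (by decide), key _ _ 2835 (by decide) (by decide),
    key _ _ 14175 (by decide) (by decide), key _ _ 155925 (by decide) (by decide)⟩

lemma twoDvd_cofactor_of_valParts_le (hv0 : v 0 = 0) (hv : v 1 = 0) (hg : valParts v ≤ 9)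
    (hex : ¬ IsExceptional v) :
    ∃ V, TwoDvd V (cofactor v) ∧ shWt v / 2 - 1 < 2 ^ V ∧ (valParts v = 9 → 5 ≤ V) := by
  have hs := support_subset_of_valParts_le hv0 hv hg
  have hW : shWt v = 3 * v 2 + 4 * v 3 + 5 * v 4 + 6 * v 5 + 7 * v 6 + 8 * v 7 + 9 * v 8 +
      10 * v 9 + 11 * v 10 + 12 * v 11 := by
    rw [shWt_eq, Finsupp.sum_of_support_subset v hs _ (by simp)]
    simp [Finset.sum_Ico_eq_sum_range, Finset.sum_range_succ]
  have hG : gam v = (3 ^ v 2 * (v 2).factorial) * (4 ^ v 3 * (v 3).factorial) *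
      (5 ^ v 4 * (v 4).factorial) * (6 ^ v 5 * (v 5).factorial) * (7 ^ v 6 * (v 6).factorial) *
      (8 ^ v 7 * (v 7).factorial) * (9 ^ v 8 * (v 8).factorial) *
      (10 ^ v 9 * (v 9).factorial) * (11 ^ v 10 * (v 10).factorial) *
      (12 ^ v 11 * (v 11).factorial) := by
    rw [gam, Finsupp.prod_of_support_subset v hs _ (by simp)]
    simp [Finset.prod_Ico_eq_prod_range, Finset.prod_range_succ]
  obtain ⟨p2, p3, p4, p5, p6, p7, p8, p9, p10, p11⟩ := padicValNat_two_factorial_values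
  have hgv : valParts v = v 2 + v 3 + 3 * v 4 + 3 * v 5 + 4 * v 6 + 4 * v 7 + 7 * v 8 +
      7 * v 9 + 8 * v 10 + 8 * v 11 := by
    rw [valParts, Finsupp.sum_of_support_subset v hs _ (by simp)]
    simp only [Finset.sum_Ico_eq_sum_range, Finset.sum_range_succ, Finset.sum_range_zero,
      Nat.reduceAdd, Nat.reduceSub, p2, p3, p4, p5, p6, p7, p8, p9, p10, p11]
    ring
  rw [hgv] at hg
  rcases cofactorBoundOrExceptional_enum (v 2) (by omega) (v 3) (by omega) (v 4) (by omega)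
    (v 5) (by omega)
    (v 6) (by omega) (v 7) (by omega) (v 8) (by omega) (v 9) (by omega) (v 10) (by omega)
    (v 11) (by omega) with h | ⟨⟨h8, h9, h10, h11, h4, h5, h6⟩, h⟩
  · rw [← hW, ← hG, ← hgv] at h
    obtain ⟨V, -, hV, h9, d, hd⟩ := h
    have hB : Odd (10395 ^ 15) := by decide
    generalize 10395 ^ 15 = B at hd hB
    refine ⟨V, ⟨d, B, by exact_mod_cast hB, ?_⟩, hV, h9⟩
    have hg := gam_pos v
    have hg' : (gam v : ℚ) ≠ 0 := by positivity
    rw [cofactor, div_mul_eq_mul_div, div_eq_iff hg']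
    push_cast
    have : (2 : ℚ) ^ (shWt v / 2 - 1) * (shWt v / 2 - 1).factorial * B =
      2 ^ V * gam v * d := by exact_mod_cast hd
    rw [this]
    ring
  · exfalso
    refine hex ?_
    have key : v = Finsupp.single 2 (v 2) + Finsupp.single 3 (v 3) + Finsupp.single 7 (v 7) := by
      refine eq_single_add_single_add_single fun i hi2 hi3 hi7 => ?_
      by_contra hne
      have hmem := Finset.mem_Ico.mp (hs (Finsupp.mem_support_iff.mpr hne))
      obtain ⟨hi, hi'⟩ := hmem
      interval_cases i <;> contradiction
    rcases h with ⟨h2, h7, h3⟩ | ⟨h2, h7, h3⟩ | ⟨h2, h7, h3⟩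
    · left
      simpa [h2, h3, h7] using key
    · right; left
      exact ⟨v 3, h3, by simpa [h2, h7] using key⟩
    · right; right
      exact ⟨v 3, h3, by simpa [h2, h7] using key⟩

lemma eight_mul_sq_le_two_pow (g : ℕ) (hg : 10 ≤ g) : 8 * g ^ 2 ≤ 2 ^ g := by
  induction g, hg using Nat.le_induction with
  | base => norm_num
  | succ g hg ih =>
    rw [pow_succ 2]
    nlinarith

lemma exists_twoDvd_cofactor_of_ten_le (hv0 : v 0 = 0) (hv : v 1 = 0) (hg : 10 ≤ valParts v) :
    ∃ c, 2 ^ c ≤ 4 * valParts v ∧ TwoDvd (valParts v - c) (cofactor v) ∧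
      shWt v / 2 - 1 < 2 ^ (valParts v - c) := by
  have hne : v ≠ 0 := by
    rintro rfl
    simp [valParts] at hg
  obtain ⟨c, hc, h⟩ := twoDvd_cofactor (v := v) ((three_le_shWt hv0 hv hne).trans' (by norm_num))
  have hW := shWt_le hv0 hv
  have h8 := eight_mul_sq_le_two_pow _ hg
  have hcg : c ≤ valParts v := by
    refine (Nat.pow_le_pow_iff_right (a := 2) (by norm_num)).mp ?_
    nlinarith
  refine ⟨c, hc.trans hW, h hcg, ?_⟩
  have h1 : shWt v / 2 - 1 < 2 * valParts v := by omega
  refine lt_of_mul_lt_mul_left (a := 2 ^ c) ?_ (Nat.zero_le _)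
  rw [← pow_add, Nat.add_sub_cancel' hcg]
  calc 2 ^ c * (shWt v / 2 - 1) < 2 ^ c * (2 * valParts v) :=
        Nat.mul_lt_mul_of_pos_left h1 (by positivity)
    _ ≤ 4 * valParts v * (2 * valParts v) := Nat.mul_le_mul_right _ (hc.trans hW)
    _ ≤ _ := by nlinarith

lemma exists_twoDvd_cofactor (hv0 : v 0 = 0) (hv : v 1 = 0) (hex : ¬ IsExceptional v) :
    ∃ V, TwoDvd V (cofactor v) ∧ shWt v / 2 - 1 < 2 ^ V := by
  by_cases hg : valParts v ≤ 9
  · obtain ⟨V, h1, h2, -⟩ := twoDvd_cofactor_of_valParts_le hv0 hv hg hex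
    exact ⟨V, h1, h2⟩
  · obtain ⟨c, -, h1, h2⟩ := exists_twoDvd_cofactor_of_ten_le hv0 hv (by omega)
    exact ⟨_, h1, h2⟩

lemma four_mul_two_pow_le (g : ℕ) (hg : 13 ≤ g) : 4 * g * 2 ^ (g / 2) < 2 ^ g := by
  induction g using Nat.strong_induction_on with
  | _ g ih =>
    by_cases h : g < 15
    · interval_cases g <;> norm_num
    · obtain ⟨k, rfl⟩ := Nat.exists_eq_add_of_le' (show 2 ≤ g by omega)
      have := ih k (by omega) (by omega)
      rw [show (k + 2) / 2 = k / 2 + 1 by omega, pow_succ, pow_add]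
      nlinarith [Nat.two_pow_pos (k / 2)]

lemma twoDvd_cofactor_of_lt {N m : ℕ} (hm : 2 * N + 1 ≤ m) (hmmod : m % 4 = 2) (hm10 : 10 ≤ m)
    (hv0 : v 0 = 0) (hv : v 1 = 0) (hex : ¬ IsExceptional v)
    (hlt : m + (shWt v / 2 - 1) < wt v) : TwoDvd (N + 1) (cofactor v) := by
  have h1 := wt_le (v := v)
  have hg : m ≤ valParts v + 1 := by
    rw [shWt] at hlt
    omega
  by_cases hg9 : valParts v ≤ 9
  · obtain ⟨V, h1, -, h2⟩ := twoDvd_cofactor_of_valParts_le hv0 hv hg9 hex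
    exact h1.mono (by omega)
  · obtain ⟨c, hc, h1, -⟩ := exists_twoDvd_cofactor_of_ten_le hv0 hv (by omega)
    refine h1.mono ?_
    generalize valParts v = g at *
    by_cases hg13 : g < 13
    · have : c < 6 := by
        refine (Nat.pow_lt_pow_iff_right (a := 2) (by norm_num)).mp ?_
        omega
      omega
    · have h4 := four_mul_two_pow_le g (by omega)
      have : c + g / 2 < g := by
        refine (Nat.pow_lt_pow_iff_right (a := 2) (by norm_num)).mp ?_
        rw [pow_add]
        nlinarith [Nat.two_pow_pos (g / 2)]
      omega

end
lemma two_pow_dvd_mul_choose (N k V i : ℕ) (hi : ¬ 2 ^ V ∣ i) :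
    2 ^ (N + 1) ∣ 2 ^ V * (k * 2 ^ N).choose i := by
  have hi0 : i ≠ 0 := by
    rintro rfl
    simp at hi
  obtain ⟨a, b, hb, rfl⟩ := Nat.exists_eq_two_pow_mul_odd hi0
  have ha : a < V := by
    by_contra h
    exact hi ((pow_dvd_pow 2 (by omega)).mul_right b)
  rcases Nat.eq_zero_or_pos k with rfl | hk
  · rw [zero_mul, Nat.choose_eq_zero_of_lt (by omega)]
    simp
  obtain ⟨l, hl⟩ := Nat.exists_eq_add_of_le' (show 1 ≤ k * 2 ^ N by
    have := Nat.two_pow_pos N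
    nlinarith)
  obtain ⟨j, hj⟩ := Nat.exists_eq_add_of_le' (show 1 ≤ 2 ^ a * b by omega)
  have h := Nat.add_one_mul_choose_eq l j
  rw [← hl, ← hj] at h
  have hc : Nat.Coprime (2 ^ (N + 1)) b := (Nat.coprime_two_left.mpr hb).pow_left _
  refine hc.dvd_of_dvd_mul_left ?_
  obtain ⟨d, rfl⟩ := Nat.exists_eq_add_of_lt ha
  refine ⟨2 ^ d * (k * l.choose j), ?_⟩
  calc b * (2 ^ (a + d + 1) * (k * 2 ^ N).choose (2 ^ a * b))
      = 2 ^ (d + 1) * ((k * 2 ^ N).choose (2 ^ a * b) * (2 ^ a * b)) := by ring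
    _ = _ := by rw [← h]; ring

lemma choose_add_eq (l y h : ℕ) : (y + l).choose h =
    y.choose h + ∑ i ∈ Finset.range h, l.choose (i + 1) * y.choose (h - (i + 1)) := by
  rw [add_comm y l, Nat.add_choose_eq, Finset.Nat.sum_antidiagonal_eq_sum_range_succ
    (fun i j => l.choose i * y.choose j), Finset.sum_range_succ']
  simp [add_comm]

lemma factorial_mul_choose_eq_prod (y h : ℕ) :
    (h.factorial : ℤ) * y.choose h = ∏ j ∈ Finset.range h, ((y : ℤ) - j) := by
  rw [← descPochhammer_eval_eq_prod_range, descPochhammer_eval_eq_descFactorial,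
    Nat.descFactorial_eq_factorial_mul_choose]
  push_cast
  rfl

section

variable {N k : ℕ} {q : ℚ} {V : ℕ}

lemma twoDvd_mul_choose_of_not_dvd (hq : TwoDvd V q) {i : ℕ} (hi : ¬ 2 ^ V ∣ i) (z : ℕ) :
    TwoDvd (N + 1) (q * (((k * 2 ^ N).choose i : ℚ) * z)) := by
  obtain ⟨a, b, hb, h⟩ := hq
  obtain ⟨c, hc⟩ := two_pow_dvd_mul_choose N k V i hi
  refine ⟨a * c * z, b, hb, ?_⟩
  have hc' : (2 : ℚ) ^ V * (k * 2 ^ N).choose i = 2 ^ (N + 1) * c := by exact_mod_cast hc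
  push_cast
  linear_combination (((k * 2 ^ N).choose i : ℚ) * z) * h + (a * z : ℚ) * hc'

lemma twoDvd_mul_choose_sub (hq : TwoDvd V q) {y h : ℕ} (hh : h < 2 ^ V) :
    TwoDvd (N + 1) (q * (((y + k * 2 ^ N).choose h : ℚ) - y.choose h)) := by
  rw [choose_add_eq]
  push_cast
  rw [add_sub_cancel_left, Finset.mul_sum]
  refine TwoDvd.sum fun i hi => twoDvd_mul_choose_of_not_dvd hq (fun hd => ?_) _
  have := Nat.le_of_dvd (by omega) hd
  rw [Finset.mem_range] at hi
  omega

lemma twoDvd_mul_choose_sub_sub (hq : TwoDvd V q) {y h j : ℕ} (hj : j + 1 = 2 ^ V)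
    (hh : h < 2 * 2 ^ V) (hjh : j < h) :
    TwoDvd (N + 1) (q * (((y + k * 2 ^ N).choose h : ℚ) - y.choose h) -
      q * (((k * 2 ^ N).choose (2 ^ V) : ℚ) * y.choose (h - 2 ^ V))) := by
  rw [choose_add_eq]
  push_cast
  rw [add_sub_cancel_left, ← Finset.sum_erase_add _ _ (Finset.mem_range.mpr hjh), hj, mul_add,
    add_sub_cancel_right, Finset.mul_sum]
  refine TwoDvd.sum fun i hi => twoDvd_mul_choose_of_not_dvd hq (fun hd => ?_) _
  rw [Finset.mem_erase, Finset.mem_range] at hi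
  obtain ⟨c, hc⟩ := hd
  have h0 : c ≠ 0 := by
    rintro rfl
    omega
  have h1 : c ≠ 1 := by
    rintro rfl
    omega
  have : 2 ≤ c := by omega
  nlinarith

lemma twoDvd_oddProd_sub_one (hN : 3 ≤ N) (y : ℤ) :
    TwoDvd (N + 1) ((oddProd y (k * 2 ^ N) : ℚ) - 1) := by
  obtain ⟨c, hc⟩ := oddProd_modEq N k hN y
  have : TwoDvd (N + 1) ((oddProd y (k * 2 ^ N) - 1 : ℤ) : ℚ) := by
    refine TwoDvd.of_dvd ⟨k * (1 + y ^ 2) + 4 * c, ?_⟩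
    rw [hc]
    push_cast
    ring
  exact_mod_cast this

lemma twoDvd_reduce (hN : 3 ≤ N) (hq : TwoDvd 0 q) (y h : ℕ) (y' : ℤ) :
    TwoDvd (N + 1) (q * ((oddProd y' (k * 2 ^ N) : ℚ) * (y + k * 2 ^ N).choose h - y.choose h) -
      q * (((y + k * 2 ^ N).choose h : ℚ) - y.choose h)) := by
  have h1 := (twoDvd_oddProd_sub_one (k := k) hN y').mul
    (hq.mul (TwoDvd.nat ((y + k * 2 ^ N).choose h)))
  simp only [add_zero] at h1
  convert h1 using 1
  ring

lemma TwoDvd.of_sub {t : ℕ} {x y : ℚ} (h : TwoDvd t (x - y)) (hy : TwoDvd t y) : TwoDvd t x := by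
  simpa using h.add hy

/-- The difference of the two coefficients belonging to the partitions `1 ^ x v` and
`1 ^ (x - l) v`. -/
lemma tau_sub_tau {v : ℕ →₀ ℕ} (hv0 : v 0 = 0) (hv : v 1 = 0) (hne : v ≠ 0) {l x : ℕ}
    (hl : Even l) (hlx : l ≤ x + (shWt v / 2 - 1)) :
    tau (Finsupp.single 1 x + v) -
      (if l ≤ x then tau (Finsupp.single 1 (x - l) + v) else 0) =
    (-1) ^ (x + deg v - 1) * (oddProd 0 (x + ((shWt v + 1) / 2 - 1) - l) * (cofactor v *
      (oddProd ((x + ((shWt v + 1) / 2 - 1) - l : ℕ) : ℤ) l *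
        (x + (shWt v / 2 - 1) - l + l).choose (shWt v / 2 - 1) -
        (x + (shWt v / 2 - 1) - l).choose (shWt v / 2 - 1)))) := by
  have hW := three_le_shWt hv0 hv hne
  rw [tau_single_add hv (by omega), Nat.sub_add_cancel hlx]
  have e : oddProd 0 (x + ((shWt v + 1) / 2 - 1)) =
      oddProd 0 (x + ((shWt v + 1) / 2 - 1) - l) *
        oddProd ((x + ((shWt v + 1) / 2 - 1) - l : ℕ) : ℤ) l := by
    have h := oddProd_add 0 (x + ((shWt v + 1) / 2 - 1) - l) l
    rwa [Nat.sub_add_cancel (by omega), zero_add] at h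
  rw [e]
  split_ifs with h
  · have hd : 1 ≤ deg v := by
      obtain ⟨i, hi⟩ := Finsupp.ne_iff.mp hne
      exact (Nat.one_le_iff_ne_zero.mpr hi).trans
        (Finset.single_le_sum (f := fun i => v i) (fun _ _ => Nat.zero_le _)
          (Finsupp.mem_support_iff.mpr hi))
    rw [tau_single_add hv (by omega), show x + ((shWt v + 1) / 2 - 1) - l =
      x - l + ((shWt v + 1) / 2 - 1) by omega, show x + (shWt v / 2 - 1) - l =
      x - l + (shWt v / 2 - 1) by omega]
    have es : ((-1 : ℚ)) ^ (x + deg v - 1) = (-1) ^ (x - l + deg v - 1) := by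
      rw [show x + deg v - 1 = (x - l + deg v - 1) + l by omega, pow_add, hl.neg_one_pow, mul_one]
    rw [es]
    push_cast
    ring
  · rw [Nat.choose_eq_zero_of_lt (show x + (shWt v / 2 - 1) - l < shWt v / 2 - 1 by omega)]
    push_cast
    ring

lemma twoDvd_sign_mul_odd_mul_sub {t : ℕ} {o : ℤ} (ho : Odd o) (e : ℕ) {x : ℚ} {l : ℕ}
    (hl : 2 ^ t ∣ l) (h : TwoDvd (t + 1) (x - l)) :
    TwoDvd (t + 1) ((-1) ^ e * (o * x) - l) := by
  obtain ⟨s, hs, hse⟩ : ∃ s : ℤ, Odd s ∧ (-1 : ℚ) ^ e * o = s :=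
    ⟨(-1) ^ e * o, (odd_one.neg.pow).mul ho, by push_cast; rfl⟩
  obtain ⟨w, rfl⟩ := hs
  obtain ⟨c, rfl⟩ := hl
  have h1 := (TwoDvd.int (2 * w + 1)).mul h
  have h2 : TwoDvd (t + 1) ((2 ^ (t + 1) * (c * w) : ℤ) : ℚ) := TwoDvd.of_dvd ⟨_, rfl⟩
  rw [zero_add] at h1
  convert h1.add h2 using 1
  rw [← mul_assoc, hse]
  push_cast
  ring

end

section

/-- The falling factorial form of a difference of binomial coefficients. -/
lemma factorial_mul_choose_sub_choose (y l h : ℕ) :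
    (h.factorial : ℤ) * ((y + l).choose h - y.choose h) =
      ∏ j ∈ Finset.range h, ((y : ℤ) + l - j) - ∏ j ∈ Finset.range h, ((y : ℤ) - j) := by
  rw [mul_sub, factorial_mul_choose_eq_prod, factorial_mul_choose_eq_prod]
  push_cast
  rfl

lemma six_mul_choose_sub_choose (r L : ℕ) :
    ∃ w : ℤ, 6 * (((4 * r + 3 + 8 * L).choose 3 : ℤ) - (4 * r + 3).choose 3) =
      8 * L * (3 + 8 * w) := by
  have e := factorial_mul_choose_sub_choose (4 * r + 3) (8 * L) 3
  simp only [Finset.prod_range_succ, Finset.prod_range_zero, Nat.factorial] at e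
  push_cast at e
  exact ⟨1 + 6 * L + 8 * L ^ 2 + 6 * r + 12 * r * L + 6 * r ^ 2, by linear_combination e⟩

lemma hundred_twenty_mul_choose_sub_choose (r L : ℕ) :
    ∃ w : ℤ, 120 * (((4 * r + 2 + 8 * L).choose 5 : ℤ) - (4 * r + 2).choose 5) =
      8 * L * (4 + 8 * w) := by
  have e := factorial_mul_choose_sub_choose (4 * r + 2) (8 * L) 5
  simp only [Finset.prod_range_succ, Finset.prod_range_zero, Nat.factorial] at e
  push_cast at e
  exact ⟨-40 * L ^ 2 + 512 * L ^ 4 + -60 * r * L + 1280 * r * L ^ 3 + -30 * r ^ 2 +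
    1280 * r ^ 2 * L ^ 2 + 640 * r ^ 3 * L + 160 * r ^ 4, by linear_combination e⟩

lemma five_thousand_forty_mul_choose_sub_choose (r L : ℕ) :
    ∃ w : ℤ, 5040 * (((4 * r + 1 + 8 * L).choose 7 : ℤ) - (4 * r + 1).choose 7) =
      8 * L * (8 + 16 * L + 32 * w) := by
  have e := factorial_mul_choose_sub_choose (4 * r + 1) (8 * L) 7
  simp only [Finset.prod_range_succ, Finset.prod_range_zero, Nat.factorial] at e
  push_cast at e
  obtain ⟨s, hs⟩ := Int.even_mul_succ_self (r : ℤ)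
  exact ⟨-4 + 38 * L + 98 * L ^ 2 + -2240 * L ^ 3 + 8960 * L ^ 4 + -14336 * L ^ 5 +
    8192 * L ^ 6 + 38 * r + s + 147 * r * L + -4480 * r * L ^ 2 + 22400 * r * L ^ 3 +
    -43008 * r * L ^ 4 + 28672 * r * L ^ 5 + 73 * r ^ 2 + -3360 * r ^ 2 * L +
    22400 * r ^ 2 * L ^ 2 + -53760 * r ^ 2 * L ^ 3 + 43008 * r ^ 2 * L ^ 4 + -1120 * r ^ 3 +
    11200 * r ^ 3 * L + -35840 * r ^ 3 * L ^ 2 + 35840 * r ^ 3 * L ^ 3 + 2800 * r ^ 4 +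
    -13440 * r ^ 4 * L + 17920 * r ^ 4 * L ^ 2 + -2688 * r ^ 5 + 5376 * r ^ 5 * L +
    896 * r ^ 6, by linear_combination e + 128 * L * hs⟩

lemma six_mul_choose_sub_choose' (r L : ℕ) :
    ∃ w : ℤ, 6 * (((4 * r + 2 + 8 * L).choose 3 : ℤ) - (4 * r + 2).choose 3) =
      8 * L * (2 * w) := by
  have e := factorial_mul_choose_sub_choose (4 * r + 2) (8 * L) 3
  simp only [Finset.prod_range_succ, Finset.prod_range_zero, Nat.factorial] at e
  push_cast at e
  exact ⟨1 + 12 * L + 32 * L ^ 2 + 12 * r + 48 * r * L + 24 * r ^ 2, by linear_combination e⟩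

lemma two_mul_choose_sub_choose (r L : ℕ) :
    ∃ w : ℤ, 2 * (((4 * r + 3 + 8 * L).choose 2 : ℤ) - (4 * r + 3).choose 2) =
      8 * L * (5 + 8 * w) := by
  have e := factorial_mul_choose_sub_choose (4 * r + 3) (8 * L) 2
  simp only [Finset.prod_range_succ, Finset.prod_range_zero, Nat.factorial] at e
  push_cast at e
  exact ⟨L + r, by linear_combination e⟩

lemma twenty_four_mul_choose_sub_choose (r L : ℕ) :
    ∃ w : ℤ, 24 * (((4 * r + 2 + 8 * L).choose 4 : ℤ) - (4 * r + 2).choose 4) =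
      8 * L * (2 + 4 * w) := by
  have e := factorial_mul_choose_sub_choose (4 * r + 2) (8 * L) 4
  simp only [Finset.prod_range_succ, Finset.prod_range_zero, Nat.factorial] at e
  push_cast at e
  exact ⟨-1 + -2 * L + 32 * L ^ 2 + 128 * L ^ 3 + -2 * r + 48 * r * L + 256 * r * L ^ 2 +
    24 * r ^ 2 + 192 * r ^ 2 * L + 64 * r ^ 3, by linear_combination e⟩

lemma odd_choose_seven (L : ℕ) : Odd ((8 * L + 7).choose 7) := by
  have e := factorial_mul_choose_eq_prod (8 * L + 7) 7
  simp only [Finset.prod_range_succ, Finset.prod_range_zero, Nat.factorial] at e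
  push_cast at e
  have h : (315 : ℤ) * (8 * L + 7).choose 7 = (8 * L + 7) * (4 * L + 3) * (8 * L + 5) *
      (2 * L + 1) * (8 * L + 3) * (4 * L + 1) * (8 * L + 1) := by
    linarith
  have h2 : Odd ((315 : ℤ) * (8 * L + 7).choose 7) := by
    rw [h]
    refine ((((((Odd.mul ?_ ?_).mul ?_).mul ?_).mul ?_).mul ?_).mul ?_)
    exacts [⟨4 * L + 3, by ring⟩, ⟨2 * L + 1, by ring⟩, ⟨4 * L + 2, by ring⟩, ⟨L, by ring⟩,
      ⟨4 * L + 1, by ring⟩, ⟨2 * L, by ring⟩, ⟨4 * L, by ring⟩]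
  exact_mod_cast (Int.odd_mul.mp h2).2

lemma odd_choose_three (r : ℕ) : Odd ((4 * r + 3).choose 3) := by
  have e := factorial_mul_choose_eq_prod (4 * r + 3) 3
  simp only [Finset.prod_range_succ, Finset.prod_range_zero, Nat.factorial] at e
  push_cast at e
  have h : (3 : ℤ) * (4 * r + 3).choose 3 = (4 * r + 3) * (2 * r + 1) * (4 * r + 1) := by
    linarith
  have h2 : Odd ((3 : ℤ) * (4 * r + 3).choose 3) := by
    rw [h]
    refine (Odd.mul ?_ ?_).mul ?_
    exacts [⟨2 * r + 1, by ring⟩, ⟨r, by ring⟩, ⟨2 * r, by ring⟩]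
  exact_mod_cast (Int.odd_mul.mp h2).2

lemma even_choose_seven (r : ℕ) : Even ((4 * r + 1).choose 7) := by
  have e := factorial_mul_choose_eq_prod (4 * r + 1) 7
  simp only [Finset.prod_range_succ, Finset.prod_range_zero, Nat.factorial] at e
  push_cast at e
  have h : (315 : ℤ) * (4 * r + 1).choose 7 = 2 * ((4 * r + 1) * r * (4 * r - 1) *
      (2 * r - 1) * (4 * r - 3) * (r - 1) * (4 * r - 5)) := by
    linarith
  have h2 : Even ((315 : ℤ) * (4 * r + 1).choose 7) := by
    rw [h]
    exact even_two_mul _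
  have h3 := (Int.even_mul.mp h2).resolve_left (by decide)
  exact_mod_cast h3

lemma eight_mul_choose_eight (L : ℕ) :
    8 * (8 * (L + 1)).choose 8 = 8 * (L + 1) * (8 * L + 7).choose 7 := by
  have := Nat.add_one_mul_choose_eq (8 * L + 7) 7
  rw [show 8 * (L + 1) = 8 * L + 7 + 1 by ring, this]
  ring

end

section

lemma exists_oddProd_zero_four_mul (r : ℕ) : ∃ e, oddProd 0 (4 * r) = 1 + 8 * e := by
  have h := (oddProd_zero_modEq_one r).dvd
  obtain ⟨c, hc⟩ := h
  rw [oddProd_add, show oddProd (0 + (4 * r : ℕ)) 1 = 8 * r + 1 by simp [oddProd]; ring] at hc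
  exact ⟨-2 * c - oddProd 0 (4 * r) * r, by linear_combination -hc⟩

lemma exists_oddProd_zero_four_mul_add_one (r : ℕ) :
    ∃ e, oddProd 0 (4 * r + 1) = 1 + 16 * e := by
  obtain ⟨c, hc⟩ := (oddProd_zero_modEq_one r).dvd
  exact ⟨-c, by linear_combination -hc⟩

lemma exists_oddProd_zero_four_mul_add_three (r : ℕ) :
    ∃ e, oddProd 0 (4 * r + 3) = 7 + 8 * e := by
  obtain ⟨e, he⟩ := exists_oddProd_zero_four_mul_add_one r
  rw [show 4 * r + 3 = 4 * r + 1 + 2 by ring, oddProd_add, he,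
    show oddProd (0 + (4 * r + 1 : ℕ)) 2 = (8 * r + 3) * (8 * r + 5) by
      simp [oddProd, Finset.prod_range_succ]; ring]
  exact ⟨1 + 8 * r ^ 2 + 8 * r + 2 * e * (8 * r + 3) * (8 * r + 5), by ring⟩

variable {N k : ℕ}

lemma exists_two_pow_eq (hN : 3 ≤ N) : ∃ M, 2 ^ N = 8 * M ∧ M = 2 ^ (N - 3) :=
  ⟨2 ^ (N - 3), by rw [← Nat.add_sub_cancel' hN, pow_add]; simp, rfl⟩

lemma twoDvd_core_three_one (hN : 3 ≤ N) (r : ℕ) :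
    TwoDvd (N + 1) (-(oddProd 0 (4 * r) * (1 / 2 * (oddProd (4 * r : ℕ) (k * 2 ^ N) *
      (4 * r + k * 2 ^ N).choose 1 - (4 * r).choose 1))) - -((k * 2 ^ N : ℕ) / 2)) := by
  obtain ⟨e, he⟩ := exists_oddProd_zero_four_mul r
  obtain ⟨c, hc⟩ := oddProd_modEq N k hN (4 * r : ℕ)
  obtain ⟨M, hM, -⟩ := exists_two_pow_eq hN
  have hM'' : (2 : ℚ) ^ N = 8 * M := by exact_mod_cast hM
  rw [he, hc]
  refine ⟨-(2 * (k * (1 + 16 * r ^ 2) + 4 * c) * (r + 2 * k * M) + 2 * e * k +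
    16 * e * (k * (1 + 16 * r ^ 2) + 4 * c) * (r + 2 * k * M)), 1, odd_one, ?_⟩
  simp only [Nat.choose_one_right]
  push_cast
  rw [pow_add, pow_add, hM'']
  ring

lemma twoDvd_core_three_two (hN : 3 ≤ N) (r : ℕ) :
    TwoDvd (N + 1) (-(oddProd 0 (4 * r + 3) * (3 / 2 * (oddProd (4 * r + 3 : ℕ) (k * 2 ^ N) *
      (4 * r + 3 + k * 2 ^ N).choose 3 - (4 * r + 3).choose 3))) - 3 * (k * 2 ^ N : ℕ) / 4) := by
  obtain ⟨e, he⟩ := exists_oddProd_zero_four_mul_add_three r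
  obtain ⟨c, hc⟩ := oddProd_modEq N k hN (4 * r + 3 : ℕ)
  obtain ⟨M, hM, -⟩ := exists_two_pow_eq hN
  have hM'' : (2 : ℚ) ^ N = 8 * M := by exact_mod_cast hM
  obtain ⟨w, hw⟩ := six_mul_choose_sub_choose r (k * M)
  rw [show 8 * (k * M) = k * 2 ^ N by rw [hM]; ring] at hw
  rw [he, hc]
  have hw' : (6 : ℚ) * (((4 * r + 3 + k * 2 ^ N).choose 3 : ℚ) - (4 * r + 3).choose 3) =
      8 * (k * M) * (3 + 8 * w) := by exact_mod_cast hw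
  refine ⟨-3 * (7 + 8 * e) * ((4 * r + 3 + k * 2 ^ N).choose 3) *
    (k * (5 + 12 * r + 8 * r ^ 2) + 2 * c) - k * (3 + 3 * e + (7 + 8 * e) * w), 1, odd_one, ?_⟩
  push_cast
  rw [pow_add, pow_add, hM'']
  linear_combination (-(7 + 8 * e) / 4 : ℚ) * hw'

/-- A multiple of `l` by an odd number is congruent to `l` modulo `2 ^ (N + 1)`. -/
lemma twoDvd_mul_odd_sub {q : ℚ} (hq : TwoDvd 0 ((q - 1) / 2)) :
    TwoDvd (N + 1) ((k * 2 ^ N : ℕ) * q - (k * 2 ^ N : ℕ)) := by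
  obtain ⟨a, b, hb, h⟩ := hq
  refine ⟨k * a, b, hb, ?_⟩
  push_cast
  linear_combination (2 * k * 2 ^ N : ℚ) * h

lemma twoDvd_core_three_three (hN : 3 ≤ N) (r : ℕ) :
    TwoDvd (N + 1) (10 * (oddProd (4 * r + 2 : ℕ) (k * 2 ^ N) *
      (4 * r + 2 + k * 2 ^ N).choose 5 - (4 * r + 2).choose 5) - (k * 2 ^ N : ℕ)) := by
  obtain ⟨M, hM, -⟩ := exists_two_pow_eq hN
  obtain ⟨w, hw⟩ := hundred_twenty_mul_choose_sub_choose r (k * M)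
  have h8 : 8 * (k * M) = k * 2 ^ N := by rw [hM]; ring
  have hw' : (120 : ℚ) * (((4 * r + 2 + k * 2 ^ N).choose 5 : ℚ) - (4 * r + 2).choose 5) =
      (k * 2 ^ N : ℕ) * (4 + 8 * w) := by rw [← h8]; exact_mod_cast hw
  have h1 := twoDvd_reduce (k := k) hN (by simpa using TwoDvd.int 10) (4 * r + 2) 5
    (4 * r + 2 : ℕ)
  have h2 : TwoDvd (N + 1) ((k * 2 ^ N : ℕ) * ((1 + 2 * w : ℚ) / 3) - (k * 2 ^ N : ℕ)) :=
    twoDvd_mul_odd_sub ⟨w - 1, 3, ⟨1, rfl⟩, by push_cast; ring⟩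
  convert h1.add h2 using 1
  linear_combination hw' / 12

lemma twoDvd_core_two_three (hN : 3 ≤ N) (r : ℕ) (y' : ℤ) :
    TwoDvd (N + 1) (2 / 3 * (oddProd y' (k * 2 ^ N) *
      (4 * r + 3 + k * 2 ^ N).choose 2 - (4 * r + 3).choose 2) - (k * 2 ^ N : ℕ)) := by
  obtain ⟨M, hM, -⟩ := exists_two_pow_eq hN
  obtain ⟨w, hw⟩ := two_mul_choose_sub_choose r (k * M)
  have h8 : 8 * (k * M) = k * 2 ^ N := by rw [hM]; ring
  have hw' : (2 : ℚ) * (((4 * r + 3 + k * 2 ^ N).choose 2 : ℚ) - (4 * r + 3).choose 2) =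
      (k * 2 ^ N : ℕ) * (5 + 8 * w) := by rw [← h8]; exact_mod_cast hw
  have h1 := twoDvd_reduce (k := k) hN (q := 2 / 3) ⟨2, 3, ⟨1, rfl⟩, by norm_num⟩ (4 * r + 3) 2 y'
  have h2 : TwoDvd (N + 1) ((k * 2 ^ N : ℕ) * ((5 + 8 * w : ℚ) / 3) - (k * 2 ^ N : ℕ)) :=
    twoDvd_mul_odd_sub ⟨1 + 4 * w, 3, ⟨1, rfl⟩, by push_cast; ring⟩
  convert h1.add h2 using 1
  linear_combination hw' / 3

lemma twoDvd_core_two_three_three (hN : 3 ≤ N) (r : ℕ) (y' : ℤ) :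
    TwoDvd (N + 1) (4 * (oddProd y' (k * 2 ^ N) *
      (4 * r + 2 + k * 2 ^ N).choose 4 - (4 * r + 2).choose 4) - (k * 2 ^ N : ℕ)) := by
  obtain ⟨M, hM, -⟩ := exists_two_pow_eq hN
  obtain ⟨w, hw⟩ := twenty_four_mul_choose_sub_choose r (k * M)
  have h8 : 8 * (k * M) = k * 2 ^ N := by rw [hM]; ring
  have hw' : (24 : ℚ) * (((4 * r + 2 + k * 2 ^ N).choose 4 : ℚ) - (4 * r + 2).choose 4) =
      (k * 2 ^ N : ℕ) * (2 + 4 * w) := by rw [← h8]; exact_mod_cast hw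
  have h1 := twoDvd_reduce (k := k) hN (by simpa using TwoDvd.int 4) (4 * r + 2) 4 y'
  have h2 : TwoDvd (N + 1) ((k * 2 ^ N : ℕ) * ((1 + 2 * w : ℚ) / 3) - (k * 2 ^ N : ℕ)) :=
    twoDvd_mul_odd_sub ⟨w - 1, 3, ⟨1, rfl⟩, by push_cast; ring⟩
  convert h1.add h2 using 1
  linear_combination hw' / 6

lemma twoDvd_core_seven (hN : 3 ≤ N) (r : ℕ) (y' : ℤ) :
    TwoDvd (N + 1) (6 * (oddProd y' (k * 2 ^ N) *
      (4 * r + 2 + k * 2 ^ N).choose 3 - (4 * r + 2).choose 3)) := by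
  obtain ⟨M, hM, -⟩ := exists_two_pow_eq hN
  obtain ⟨w, hw⟩ := six_mul_choose_sub_choose' r (k * M)
  have h8 : 8 * (k * M) = k * 2 ^ N := by rw [hM]; ring
  have hw' : (6 : ℚ) * (((4 * r + 2 + k * 2 ^ N).choose 3 : ℚ) - (4 * r + 2).choose 3) =
      (k * 2 ^ N : ℕ) * (2 * w) := by rw [← h8]; exact_mod_cast hw
  refine (twoDvd_reduce (k := k) hN (by simpa using TwoDvd.int 6) (4 * r + 2) 3 y').of_sub ?_
  rw [hw']
  exact ⟨k * w, 1, odd_one, by push_cast; ring⟩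

lemma twoDvd_core_three_four (hN : 3 ≤ N) (hk : Odd k) (r : ℕ) {θ : ℚ}
    (hθ : θ = if N = 3 then -((k * 2 ^ N : ℕ) : ℚ) / 2 else ((k * 2 ^ N : ℕ) : ℚ) / 2) :
    TwoDvd (N + 1) (-(oddProd 0 (4 * r + 1) * (105 * (oddProd (4 * r + 1 : ℕ) (k * 2 ^ N) *
      (4 * r + 1 + k * 2 ^ N).choose 7 - (4 * r + 1).choose 7))) - θ) := by
  obtain ⟨e, he⟩ := exists_oddProd_zero_four_mul_add_one r
  obtain ⟨M, hM, hM'⟩ := exists_two_pow_eq hN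
  obtain ⟨w, hw⟩ := five_thousand_forty_mul_choose_sub_choose r (k * M)
  have h8 : 8 * (k * M) = k * 2 ^ N := by rw [hM]; ring
  have hw' : (5040 : ℚ) * (((4 * r + 1 + k * 2 ^ N).choose 7 : ℚ) - (4 * r + 1).choose 7) =
      (k * 2 ^ N : ℕ) * (8 + 16 * (k * M) + 32 * w) := by rw [← h8]; exact_mod_cast hw
  have h1 := (TwoDvd.int (oddProd 0 (4 * r + 1))).mul (twoDvd_reduce (k := k) hN
    (by simpa using TwoDvd.int 105) (4 * r + 1) 7 (4 * r + 1 : ℕ))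
  rw [zero_add] at h1
  have h2 : TwoDvd (N + 1) (-(oddProd 0 (4 * r + 1) * ((k * 2 ^ N : ℕ) *
      ((1 + 2 * (k * M) + 4 * w : ℚ) / 6))) - θ) := by
    rw [he, hθ]
    split_ifs with h3
    · obtain ⟨j, rfl⟩ := hk
      have hM1 : M = 1 := by rw [hM', h3]; rfl
      refine ⟨-((2 * j + 1) * (j + w + 4 * e * (3 + 4 * j + 4 * w))), 3, ⟨1, rfl⟩, ?_⟩
      rw [hM1]
      push_cast
      ring
    · obtain ⟨s, hs⟩ : ∃ s, M = 2 * s := by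
        refine ⟨2 ^ (N - 4), ?_⟩
        rw [hM', show N - 3 = N - 4 + 1 by omega, pow_succ]
        ring
      refine ⟨-(k * (1 + k * s + w + 4 * e * (1 + 4 * k * s + 4 * w))), 3, ⟨1, rfl⟩, ?_⟩
      rw [hs]
      push_cast
      ring
  convert h2.sub h1 using 1
  linear_combination (-oddProd 0 (4 * r + 1) / 48 : ℚ) * hw'

lemma exists_eight_mul_choose_eight (hN : 3 ≤ N) (hk : Odd k) :
    ∃ c : ℕ, Odd c ∧ (8 * (k * 2 ^ N).choose 8 : ℚ) = (k * 2 ^ N : ℕ) * c := by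
  obtain ⟨M, hM, hM'⟩ := exists_two_pow_eq hN
  obtain ⟨L, hL⟩ := Nat.exists_eq_add_of_le' (show 1 ≤ k * M from
    Nat.mul_pos hk.pos (by rw [hM']; positivity))
  have h8 : k * 2 ^ N = 8 * (L + 1) := by rw [hM, ← hL]; ring
  refine ⟨_, odd_choose_seven L, ?_⟩
  rw [h8]
  exact_mod_cast eight_mul_choose_eight L

lemma twoDvd_core_of_lt_sixteen (hN : 3 ≤ N) (hk : Odd k) {q : ℕ} (y h : ℕ) (y' : ℤ)
    (h8 : 8 ≤ h) (h16 : h < 16) :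
    ∃ c : ℕ, Odd c ∧ TwoDvd (N + 1) ((8 * q : ℕ) * (oddProd y' (k * 2 ^ N) *
      (y + k * 2 ^ N).choose h - y.choose h) - (k * 2 ^ N : ℕ) * (q * c * y.choose (h - 8))) := by
  obtain ⟨c, hc, hce⟩ := exists_eight_mul_choose_eight hN hk
  refine ⟨c, hc, ?_⟩
  have h1 := twoDvd_reduce (k := k) (q := (8 * q : ℕ)) hN (TwoDvd.nat _) y h y'
  have h2 := twoDvd_mul_choose_sub_sub (N := N) (k := k) (V := 3) (q := (8 * q : ℕ))
    (y := y) (h := h) (j := 7) ⟨q, 1, odd_one, by push_cast; ring⟩ (by norm_num)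
    (by omega) (by omega)
  convert h1.add h2 using 1
  push_cast at hce ⊢
  norm_num
  linear_combination (-q * y.choose (h - 8) : ℚ) * hce

lemma twoDvd_mul_even {z : ℕ} (hz : Even z) : TwoDvd (N + 1) ((k * 2 ^ N : ℕ) * (z : ℚ)) := by
  obtain ⟨z, rfl⟩ := hz
  exact ⟨k * z, 1, odd_one, by push_cast; ring⟩

lemma twoDvd_core_three_five (hN : 3 ≤ N) (hk : Odd k) (r : ℕ) (y' : ℤ) :
    TwoDvd (N + 1) (1512 * (oddProd y' (k * 2 ^ N) *
      (4 * r + k * 2 ^ N).choose 9 - (4 * r).choose 9)) := by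
  obtain ⟨c, hc, h⟩ := twoDvd_core_of_lt_sixteen hN hk (q := 189) (4 * r) 9 y' (by norm_num)
    (by norm_num)
  have h2 := twoDvd_mul_even (N := N) (k := k) (z := 189 * c * (4 * r).choose (9 - 8))
    (Even.mul_left (by simp [Nat.even_mul]; exact .inl (by decide)) _)
  convert h.add h2 using 1
  push_cast
  ring

lemma twoDvd_core_three_six (hN : 3 ≤ N) (hk : Odd k) (r : ℕ) (y' : ℤ) :
    TwoDvd (N + 1) (27720 * (oddProd y' (k * 2 ^ N) *
      (4 * r + 3 + k * 2 ^ N).choose 11 - (4 * r + 3).choose 11) - (k * 2 ^ N : ℕ)) := by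
  obtain ⟨c, hc, h⟩ := twoDvd_core_of_lt_sixteen hN hk (q := 3465) (4 * r + 3) 11 y' (by norm_num)
    (by norm_num)
  obtain ⟨d, hd⟩ := ((show Odd 3465 from ⟨1732, rfl⟩).mul hc).mul (odd_choose_three r)
  have h2 : TwoDvd (N + 1) ((k * 2 ^ N : ℕ) * ((2 * d + 1 : ℕ) : ℚ) - (k * 2 ^ N : ℕ)) :=
    twoDvd_mul_odd_sub ⟨d, 1, odd_one, by push_cast; ring⟩
  rw [← hd] at h2
  convert h.add h2 using 1
  push_cast
  norm_num

lemma twoDvd_core_three_eight (hN : 3 ≤ N) (hk : Odd k) (r : ℕ) (y' : ℤ) :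
    TwoDvd (N + 1) (16216200 * (oddProd y' (k * 2 ^ N) *
      (4 * r + 1 + k * 2 ^ N).choose 15 - (4 * r + 1).choose 15)) := by
  obtain ⟨c, hc, h⟩ := twoDvd_core_of_lt_sixteen hN hk (q := 2027025) (4 * r + 1) 15 y'
    (by norm_num) (by norm_num)
  have h2 := twoDvd_mul_even (N := N) (k := k) (z := 2027025 * c * (4 * r + 1).choose (15 - 8))
    (Even.mul_left (even_choose_seven r) _)
  convert h.add h2 using 1
  push_cast
  ring

end

/-- The coefficient of `c ^ (1 ^ x v)` in `B̂_n / n - c_1 ^ l * B̂_m / m`, where `n = m + l` is the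
weight of the partition `1 ^ x v`. -/
def tauDiff (l x : ℕ) (v : ℕ →₀ ℕ) : ℚ :=
  tau (Finsupp.single 1 x + v) - if l ≤ x then tau (Finsupp.single 1 (x - l) + v) else 0

section

variable {N k m x : ℕ}

lemma tauDiff_eq {v : ℕ →₀ ℕ} (hv0 : v 0 = 0) (hv : v 1 = 0) (hne : v ≠ 0) {l h h' y y' : ℕ}
    (hl : Even l) (hh : shWt v / 2 - 1 = h) (hh' : (shWt v + 1) / 2 - 1 = h')
    (hy : x + h = y + l) (hy' : x + h' = y' + l) :
    tauDiff l x v = (-1) ^ (x + deg v - 1) * (oddProd 0 y' * (cofactor v *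
      (oddProd (y' : ℕ) l * (y + l).choose h - y.choose h))) := by
  rw [tauDiff, tau_sub_tau hv0 hv hne hl (by omega), hh, hh', hy, hy', Nat.add_sub_cancel,
    Nat.add_sub_cancel]

lemma even_mul_two_pow (hN : 3 ≤ N) : Even (k * 2 ^ N) :=
  Even.mul_left ((Nat.even_pow.mpr ⟨even_two, by omega⟩)) k

lemma shWt_single (i b : ℕ) : shWt (Finsupp.single i b) = (i + 1) * b := by
  rw [shWt_eq, Finsupp.sum_single_index (by simp)]

lemma gam_single (i b : ℕ) : gam (Finsupp.single i b) = (i + 1) ^ b * b.factorial := by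
  rw [gam, Finsupp.prod_single_index (by simp)]

lemma deg_single (i b : ℕ) : deg (Finsupp.single i b) = b := by
  rw [deg, Finsupp.sum_single_index (by simp)]

lemma wt_single (i b : ℕ) : wt (Finsupp.single i b) = i * b := by
  rw [wt, Finsupp.sum_single_index (by simp)]

lemma shWt_single_add_single (b : ℕ) :
    shWt (Finsupp.single 2 1 + Finsupp.single 3 b) = 3 + 4 * b := by
  rw [shWt_eq, Finsupp.sum_add_index' (by simp) (by intros; ring),
    Finsupp.sum_single_index (by simp), Finsupp.sum_single_index (by simp)]

lemma wt_single_add_single (b : ℕ) :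
    wt (Finsupp.single 2 1 + Finsupp.single 3 b) = 2 + 3 * b := by
  rw [wt, Finsupp.sum_add_index' (by simp) (by intros; ring),
    Finsupp.sum_single_index (by simp), Finsupp.sum_single_index (by simp)]

lemma gam_single_add_single (b : ℕ) :
    gam (Finsupp.single 2 1 + Finsupp.single 3 b) = 3 * (4 ^ b * b.factorial) := by
  have h : Disjoint (Finsupp.single 2 1).support (Finsupp.single 3 b).support := by
    refine Finset.disjoint_of_subset_left Finsupp.support_single_subset ?_
    simp
  rw [gam, Finsupp.prod_add_index_of_disjoint h, Finsupp.prod_single_index (by simp),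
    Finsupp.prod_single_index (by simp)]
  simp

lemma tauDiff_single_three (hN : 3 ≤ N) (hm : m % 4 = 2) {b y : ℕ} (hb : 1 ≤ b)
    (hx : x + 3 * b = m + k * 2 ^ N) (hy : y + b + 1 = m) :
    tauDiff (k * 2 ^ N) x (Finsupp.single 3 b) =
      -(oddProd 0 y * (2 ^ (2 * b - 1) * ((2 * b - 1).factorial : ℚ) /
        ((4 ^ b * b.factorial : ℕ) : ℚ) * (oddProd (y : ℕ) (k * 2 ^ N) *
          (y + k * 2 ^ N).choose (2 * b - 1) - y.choose (2 * b - 1)))) := by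
  have hl := even_mul_two_pow (k := k) hN
  have hW := shWt_single 3 b
  rw [tauDiff_eq (l := k * 2 ^ N) (h := 2 * b - 1) (h' := 2 * b - 1) (y := y) (y' := y)
    (by simp) (by simp) (by simp; omega) hl (by omega) (by omega) (by omega) (by omega),
    cofactor, hW, gam_single, deg_single, show (3 + 1) * b / 2 - 1 = 2 * b - 1 by omega,
    Odd.neg_one_pow (by obtain ⟨c, hc⟩ := hl; exact ⟨(x + b - 2) / 2, by omega⟩)]
  ring

lemma twoDvd_tauDiff_single_three_one (hN : 3 ≤ N) (hm : m % 4 = 2)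
    (hx : x + 3 * 1 = m + k * 2 ^ N) :
    TwoDvd (N + 1) (tauDiff (k * 2 ^ N) x (Finsupp.single 3 1) - -((k * 2 ^ N : ℕ) / 2)) := by
  obtain ⟨r, hr⟩ : ∃ r, m = 4 * r + 2 := ⟨m / 4, by omega⟩
  rw [tauDiff_single_three (y := 4 * r) hN hm le_rfl hx (by omega)]
  convert twoDvd_core_three_one (k := k) hN r using 5
  norm_num [Nat.factorial]

lemma twoDvd_tauDiff_single_three_two (hN : 3 ≤ N) (hm : m % 4 = 2) (hm10 : 10 ≤ m)
    (hx : x + 3 * 2 = m + k * 2 ^ N) :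
    TwoDvd (N + 1) (tauDiff (k * 2 ^ N) x (Finsupp.single 3 2) - 3 * (k * 2 ^ N : ℕ) / 4) := by
  obtain ⟨r, hr⟩ : ∃ r, m = 4 * r + 6 := ⟨m / 4 - 1, by omega⟩
  rw [tauDiff_single_three (y := 4 * r + 3) hN hm (by omega) hx (by omega)]
  convert twoDvd_core_three_two (k := k) hN r using 5
  norm_num [Nat.factorial]

lemma twoDvd_tauDiff_single_three_three (hN : 3 ≤ N) (hm : m % 4 = 2) (hm10 : 10 ≤ m)
    (hx : x + 3 * 3 = m + k * 2 ^ N) :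
    TwoDvd (N + 1) (tauDiff (k * 2 ^ N) x (Finsupp.single 3 3) - (k * 2 ^ N : ℕ)) := by
  obtain ⟨r, hr⟩ : ∃ r, m = 4 * r + 6 := ⟨m / 4 - 1, by omega⟩
  rw [tauDiff_single_three (y := 4 * r + 2) hN hm (by omega) hx (by omega)]
  convert twoDvd_sign_mul_odd_mul_sub (odd_oddProd 0 (4 * r + 2)) 1 (Nat.dvd_mul_left _ _)
    (twoDvd_core_three_three (k := k) hN r) using 2
  norm_num [Nat.factorial]

lemma twoDvd_tauDiff_single_three_four (hN : 3 ≤ N) (hk : Odd k) (hm : m % 4 = 2) (hm10 : 10 ≤ m)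
    (hx : x + 3 * 4 = m + k * 2 ^ N) {θ : ℚ}
    (hθ : θ = if N = 3 then -((k * 2 ^ N : ℕ) : ℚ) / 2 else ((k * 2 ^ N : ℕ) : ℚ) / 2) :
    TwoDvd (N + 1) (tauDiff (k * 2 ^ N) x (Finsupp.single 3 4) - θ) := by
  obtain ⟨r, hr⟩ : ∃ r, m = 4 * r + 6 := ⟨m / 4 - 1, by omega⟩
  rw [tauDiff_single_three (y := 4 * r + 1) hN hm (by omega) hx (by omega)]
  convert twoDvd_core_three_four hN hk r hθ using 5
  norm_num [Nat.factorial]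

lemma twoDvd_tauDiff_single_three_five (hN : 3 ≤ N) (hk : Odd k) (hm : m % 4 = 2) (hm10 : 10 ≤ m)
    (hx : x + 3 * 5 = m + k * 2 ^ N) :
    TwoDvd (N + 1) (tauDiff (k * 2 ^ N) x (Finsupp.single 3 5)) := by
  obtain ⟨r, hr⟩ : ∃ r, m = 4 * r + 6 := ⟨m / 4 - 1, by omega⟩
  rw [tauDiff_single_three (y := 4 * r) hN hm (by omega) hx (by omega)]
  have h := ((TwoDvd.int (oddProd 0 (4 * r))).mul
    (twoDvd_core_three_five hN hk r (4 * r : ℕ))).neg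
  rw [zero_add] at h
  convert h using 4
  norm_num [Nat.factorial]

lemma twoDvd_tauDiff_single_three_six (hN : 3 ≤ N) (hk : Odd k) (hm : m % 4 = 2) (hm10 : 10 ≤ m)
    (hx : x + 3 * 6 = m + k * 2 ^ N) :
    TwoDvd (N + 1) (tauDiff (k * 2 ^ N) x (Finsupp.single 3 6) - (k * 2 ^ N : ℕ)) := by
  obtain ⟨r, hr⟩ : ∃ r, m = 4 * r + 10 := ⟨m / 4 - 2, by omega⟩
  rw [tauDiff_single_three (y := 4 * r + 3) hN hm (by omega) hx (by omega)]
  convert twoDvd_sign_mul_odd_mul_sub (odd_oddProd 0 (4 * r + 3)) 1 (Nat.dvd_mul_left _ _)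
    (twoDvd_core_three_six (k := k) hN hk r (4 * r + 3 : ℕ)) using 2
  norm_num [Nat.factorial]

lemma twoDvd_tauDiff_single_three_eight (hN : 3 ≤ N) (hk : Odd k) (hm : m % 4 = 2)
    (hm10 : 10 ≤ m) (hx : x + 3 * 8 = m + k * 2 ^ N) :
    TwoDvd (N + 1) (tauDiff (k * 2 ^ N) x (Finsupp.single 3 8)) := by
  obtain ⟨r, hr⟩ : ∃ r, m = 4 * r + 10 := ⟨m / 4 - 2, by omega⟩
  rw [tauDiff_single_three (y := 4 * r + 1) hN hm (by omega) hx (by omega)]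
  have h := ((TwoDvd.int (oddProd 0 (4 * r + 1))).mul
    (twoDvd_core_three_eight hN hk r (4 * r + 1 : ℕ))).neg
  rw [zero_add] at h
  convert h using 4
  norm_num [Nat.factorial]

lemma twoDvd_sign_mul {t : ℕ} {q : ℚ} (h : TwoDvd t q) (e : ℕ) (o : ℤ) :
    TwoDvd t ((-1) ^ e * (o * q)) := by
  have := (TwoDvd.int ((-1) ^ e * o)).mul h
  rw [zero_add] at this
  convert this using 1
  push_cast
  ring

lemma twoDvd_tauDiff_single_seven (hN : 3 ≤ N) (hm : m % 4 = 2) (hm10 : 10 ≤ m)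
    (hx : x + 7 = m + k * 2 ^ N) :
    TwoDvd (N + 1) (tauDiff (k * 2 ^ N) x (Finsupp.single 7 1)) := by
  obtain ⟨r, hr⟩ : ∃ r, m = 4 * r + 6 := ⟨m / 4 - 1, by omega⟩
  have hW := shWt_single 7 1
  rw [tauDiff_eq (l := k * 2 ^ N) (h := 3) (h' := 3) (y := 4 * r + 2) (y' := 4 * r + 2)
    (by simp) (by simp) (by simp) (even_mul_two_pow hN) (by omega) (by omega) (by omega)
    (by omega)]
  convert twoDvd_sign_mul (twoDvd_core_seven (k := k) hN r (4 * r + 2 : ℕ)) _ _ using 4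
  rw [cofactor, hW, gam_single]
  norm_num [Nat.factorial]

lemma twoDvd_tauDiff_two_three (hN : 3 ≤ N) (hm : m % 4 = 2) (hm10 : 10 ≤ m)
    (hx : x + 5 = m + k * 2 ^ N) :
    TwoDvd (N + 1) (tauDiff (k * 2 ^ N) x (Finsupp.single 2 1 + Finsupp.single 3 1) -
      (k * 2 ^ N : ℕ)) := by
  obtain ⟨r, hr⟩ : ∃ r, m = 4 * r + 6 := ⟨m / 4 - 1, by omega⟩
  have hW := shWt_single_add_single 1
  rw [tauDiff_eq (l := k * 2 ^ N) (h := 2) (h' := 3) (y := 4 * r + 3) (y' := 4 * r + 4)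
    (by simp) (by simp) (by simp) (even_mul_two_pow hN) (by omega) (by omega) (by omega)
    (by omega)]
  convert twoDvd_sign_mul_odd_mul_sub (odd_oddProd 0 (4 * r + 4)) _ (Nat.dvd_mul_left _ _)
    (twoDvd_core_two_three (k := k) hN r (4 * r + 4 : ℕ)) using 5
  rw [cofactor, hW, gam_single_add_single]
  norm_num [Nat.factorial]

lemma twoDvd_tauDiff_two_three_three (hN : 3 ≤ N) (hm : m % 4 = 2) (hm10 : 10 ≤ m)
    (hx : x + 8 = m + k * 2 ^ N) :
    TwoDvd (N + 1) (tauDiff (k * 2 ^ N) x (Finsupp.single 2 1 + Finsupp.single 3 2) -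
      (k * 2 ^ N : ℕ)) := by
  obtain ⟨r, hr⟩ : ∃ r, m = 4 * r + 6 := ⟨m / 4 - 1, by omega⟩
  have hW := shWt_single_add_single 2
  rw [tauDiff_eq (l := k * 2 ^ N) (h := 4) (h' := 5) (y := 4 * r + 2) (y' := 4 * r + 3)
    (by simp) (by simp) (by simp) (even_mul_two_pow hN) (by omega) (by omega) (by omega)
    (by omega)]
  convert twoDvd_sign_mul_odd_mul_sub (odd_oddProd 0 (4 * r + 3)) _ (Nat.dvd_mul_left _ _)
    (twoDvd_core_two_three_three (k := k) hN r (4 * r + 3 : ℕ)) using 5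
  rw [cofactor, hW, gam_single_add_single]
  norm_num [Nat.factorial]

lemma twoDvd_tauDiff_of_not_isExceptional (hN : 3 ≤ N) (hm : 2 * N + 1 ≤ m) (hmmod : m % 4 = 2)
    (hm10 : 10 ≤ m) {v : ℕ →₀ ℕ} (hv0 : v 0 = 0) (hv : v 1 = 0) (hex : ¬ IsExceptional v)
    (hx : x + wt v = m + k * 2 ^ N) : TwoDvd (N + 1) (tauDiff (k * 2 ^ N) x v) := by
  have hne : v ≠ 0 := by
    rintro rfl
    exact hex (.inr (.inl ⟨0, by simp, by simp⟩))
  have hW := three_le_shWt hv0 hv hne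
  by_cases hlt : x + (shWt v / 2 - 1) < k * 2 ^ N
  · rw [tauDiff, if_neg (by omega), sub_zero, tau_single_add hv (by omega)]
    have h := twoDvd_sign_mul (twoDvd_cofactor_of_lt hm hmmod hm10 hv0 hv hex (by omega))
      (x + deg v - 1) (oddProd 0 (x + ((shWt v + 1) / 2 - 1)) *
        (x + (shWt v / 2 - 1)).choose (shWt v / 2 - 1))
    exact_mod_cast h
  · obtain ⟨V, hV, hh⟩ := exists_twoDvd_cofactor hv0 hv hex
    obtain ⟨y, hy⟩ := Nat.exists_eq_add_of_le' (not_lt.mp hlt)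
    obtain ⟨y', hy'⟩ : ∃ y', x + ((shWt v + 1) / 2 - 1) = y' + k * 2 ^ N :=
      Nat.exists_eq_add_of_le' (by omega)
    rw [tauDiff_eq hv0 hv hne (even_mul_two_pow hN) rfl rfl hy hy']
    exact twoDvd_sign_mul ((twoDvd_reduce hN (hV.mono (Nat.zero_le _)) _ _ _).of_sub
      (twoDvd_mul_choose_sub hV hh)) _ _

lemma tau_single_one {x : ℕ} (hx : Even x) (hx0 : x ≠ 0) :
    tau (Finsupp.single 1 x) = -(oddProd 0 (x - 1) / (2 * x)) := by
  obtain ⟨y, rfl⟩ := Nat.exists_eq_succ_of_ne_zero hx0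
  have ho : Odd y := by
    rw [Nat.succ_eq_add_one, Nat.even_add_one] at hx
    exact Nat.not_even_iff_odd.mp hx
  have h : ((2 * y).factorial : ℚ) = ((2 * y).factorial : ℤ) := by norm_cast
  rw [tau, wt_single, deg_single, gam_single, show 1 * y.succ + y.succ - 2 = 2 * y by omega,
    Nat.succ_sub_one, ho.neg_one_pow, h, factorial_two_mul_eq, Nat.factorial_succ]
  push_cast
  rw [Nat.succ_eq_add_one, pow_succ]
  field_simp

lemma twoDvd_tauDiff_zero (hN : 3 ≤ N) (hm : m % 4 = 2) {n : ℕ} (hn : n = m + k * 2 ^ N) :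
    TwoDvd (N + 1) (tauDiff (k * 2 ^ N) n 0 -
      ((k * 2 ^ N : ℕ) + (k * 2 ^ N : ℕ) / (2 * (m : ℚ) * n))) := by
  obtain ⟨r, hr⟩ : ∃ r, m = 4 * r + 2 := ⟨m / 4, by omega⟩
  obtain ⟨e, he⟩ := exists_oddProd_zero_four_mul_add_one r
  obtain ⟨c, hc⟩ := oddProd_modEq N k hN (4 * r + 1 : ℕ)
  obtain ⟨M, hM, -⟩ := exists_two_pow_eq hN
  have hl := even_mul_two_pow (k := k) hN
  have hD : oddProd 0 (n - 1) = oddProd 0 (4 * r + 1) * oddProd (4 * r + 1 : ℕ) (k * 2 ^ N) := by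
    rw [show n - 1 = 4 * r + 1 + k * 2 ^ N by omega, oddProd_add, zero_add]
  have hn2 : n = 2 * (2 * r + 1 + 4 * (k * M)) := by rw [hn, hr, hM]; ring
  rw [tauDiff, if_pos (by omega), show n - k * 2 ^ N = m by omega, add_zero, add_zero,
    tau_single_one ⟨_, hn2.trans (two_mul _)⟩ (by omega),
    tau_single_one ⟨2 * r + 1, by omega⟩ (by omega), hD, show m - 1 = 4 * r + 1 by omega, he, hc,
    hn2, hM, show m = 2 * (2 * r + 1) by omega]
  have hM'' : (2 : ℚ) ^ N = 8 * M := by exact_mod_cast hM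
  have h1 : (2 * (r : ℚ) + 1) ≠ 0 := by positivity
  have h2 : (2 * (r : ℚ) + 1 + 4 * (k * M)) ≠ 0 := by positivity
  refine ⟨k * e - k * (1 + (3 * r + 8 * r ^ 2 + 8 * r ^ 3) +
    8 * e * (1 + 6 * r + 16 * r ^ 2 + 16 * r ^ 3) + 2 * r + 2 * r ^ 2 +
    2 * (2 * r + 1) * k * M) - (1 + 16 * e) * (2 * r + 1) * c,
    (2 * r + 1) * (2 * r + 1 + 4 * (k * M)),
    Odd.mul ⟨r, rfl⟩ ⟨r + 2 * (k * M), by ring⟩, ?_⟩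
  push_cast
  rw [pow_add, pow_add, hM'']
  field_simp
  ring

end

section

lemma sum_toMultiset_eq_wt (u : ℕ →₀ ℕ) : (Finsupp.toMultiset u).sum = wt u := by
  rw [Finsupp.toMultiset_apply, wt, Finsupp.sum, Multiset.sum_sum]
  refine Finset.sum_congr rfl fun i _ => ?_
  simp [Multiset.sum_nsmul, mul_comm]

lemma coeff_divB (n : ℕ) (u : ℕ →₀ ℕ) :
    coeff u (divB n) = if u 0 = 0 ∧ wt u = n then tau u else 0 := by
  classical
  simp only [divB, coeff_sum, coeff_smul, coeff_monomial, smul_eq_mul, mul_ite, mul_one, mul_zero]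
  split_ifs with h
  · let P : n.Partition := ⟨Finsupp.toMultiset u, fun {i} hi => by
      rw [Finsupp.mem_toMultiset, Finsupp.mem_support_iff] at hi
      rcases Nat.eq_zero_or_pos i with rfl | h'
      exacts [absurd h.1 hi, h'], by rw [sum_toMultiset_eq_wt, h.2]⟩
    have hP : P.parts.toFinsupp = u := by simp [P]
    rw [Finset.sum_eq_single P, if_pos hP, hP]
    · intro Q _ hQ
      refine if_neg fun hQu => hQ (Nat.Partition.ext ?_)
      exact Multiset.toFinsupp.injective (hQu.trans hP.symm)
    · simp
  · refine Finset.sum_eq_zero fun P _ => if_neg ?_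
    rintro rfl
    refine h ⟨?_, ?_⟩
    · rw [Multiset.toFinsupp_apply, Multiset.count_eq_zero]
      exact fun h0 => (P.parts_pos h0).false
    · rw [← sum_toMultiset_eq_wt, Multiset.toFinsupp_toMultiset, P.parts_sum]

variable {n a : ℕ} {u t : ℕ →₀ ℕ}

lemma single_add_erase_one (u : ℕ →₀ ℕ) :
    Finsupp.single 1 (u 1) + Finsupp.erase 1 u = u :=
  Finsupp.single_add_erase 1 u

lemma coeff_monomial_single_one_add (ht0 : t 0 = 0) (ht : t 1 = 0) (ha : a + wt t = n) (c : ℚ) :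
    coeff u (monomial (Finsupp.single 1 a + t) c) =
      if (u 0 = 0 ∧ wt u = n) ∧ Finsupp.erase 1 u = t then c else 0 := by
  classical
  rw [coeff_monomial]
  refine if_congr ⟨?_, ?_⟩ rfl rfl
  · rintro rfl
    refine ⟨⟨by simp [ht0], by rw [wt_single_add, ha]⟩, ?_⟩
    ext i
    by_cases hi : i = 1
    · simp [hi, ht]
    · simp [Finsupp.erase_ne hi]
  · rintro ⟨⟨h0, hw⟩, rfl⟩
    have h := wt_single_add (v := Finsupp.erase 1 u) (u 1)
    rw [single_add_erase_one] at h
    rw [show a = u 1 by omega, single_add_erase_one]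

lemma coeff_divB_sub (m l : ℕ) (h0 : u 0 = 0) (hw : wt u = m + l) :
    coeff u (divB (m + l)) - coeff u (X 1 ^ l * divB m) = tauDiff l (u 1) (Finsupp.erase 1 u) := by
  have hle : Finsupp.single 1 l ≤ u ↔ l ≤ u 1 := Finsupp.single_le_iff
  rw [X_pow_eq_monomial, coeff_monomial_mul', coeff_divB, if_pos ⟨h0, hw⟩, tauDiff,
    single_add_erase_one]
  congr 1
  by_cases h : l ≤ u 1
  · have h1 : u - Finsupp.single 1 l = Finsupp.single 1 (u 1 - l) + Finsupp.erase 1 u := by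
      ext i
      by_cases hi : i = 1
      · simp [hi]
      · simp [Finsupp.erase_ne hi, Finsupp.single_eq_of_ne hi]
    have h2 := wt_single_add (v := Finsupp.erase 1 u) (u 1)
    rw [single_add_erase_one] at h2
    rw [if_pos (hle.mpr h), if_pos h, coeff_divB, one_mul, h1, if_pos]
    refine ⟨by simp [h0], ?_⟩
    rw [wt_single_add]
    omega
  · rw [if_neg (hle.not.mpr h), if_neg h]

lemma coeff_X_one_pow_mul_divB (m l : ℕ) (h : ¬ (u 0 = 0 ∧ wt u = m + l)) :
    coeff u (X 1 ^ l * divB m) = 0 := by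
  rw [X_pow_eq_monomial, coeff_monomial_mul', coeff_divB]
  split_ifs with h1 h2
  · refine absurd ⟨by simpa using h2.1, ?_⟩ h
    rw [← h2.2, ← add_tsub_cancel_of_le h1, wt_single_add, add_tsub_cancel_left, add_comm]
  · simp
  · rfl

lemma C_mul_X_pow_mul_X_pow (a b : ℕ) (c : ℚ) :
    (C c * X 1 ^ a * X 3 ^ b : MvPolynomial ℕ ℚ) =
      monomial (Finsupp.single 1 a + Finsupp.single 3 b) c := by
  rw [monomial_add_single, C_mul_X_pow_eq_monomial]

lemma C_mul_X_pow_mul_X_mul_X_pow (a b : ℕ) (c : ℚ) :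
    (C c * X 1 ^ a * X 2 * X 3 ^ b : MvPolynomial ℕ ℚ) =
      monomial (Finsupp.single 1 a + (Finsupp.single 2 1 + Finsupp.single 3 b)) c := by
  rw [← add_assoc, monomial_add_single, monomial_add_single, C_mul_X_pow_eq_monomial, pow_one]

end

section

lemma single_two_add_single_three_ne_single_three (b c : ℕ) :
    (Finsupp.single 2 1 + Finsupp.single 3 b : ℕ →₀ ℕ) ≠ Finsupp.single 3 c := fun h => by
  simpa using DFunLike.congr_fun h 2

lemma single_two_add_single_three_ne_single_seven (b c : ℕ) :
    (Finsupp.single 2 1 + Finsupp.single 3 b : ℕ →₀ ℕ) ≠ Finsupp.single 7 c := fun h => by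
  simpa using DFunLike.congr_fun h 2

/-- The coefficient of `c ^ (1 ^ x v)` prescribed by the congruence, in weight `n = m + l`. -/
def specialCoeff (l m n : ℕ) (θ : ℚ) (v : ℕ →₀ ℕ) : ℚ :=
  (if v = Finsupp.single 3 0 then (l : ℚ) + l / (2 * m * n) else 0) +
  (if v = Finsupp.single 3 3 then (l : ℚ) else 0) +
  (if v = Finsupp.single 3 6 then (l : ℚ) else 0) +
  (if v = Finsupp.single 2 1 + Finsupp.single 3 1 then (l : ℚ) else 0) +
  (if v = Finsupp.single 2 1 + Finsupp.single 3 2 then (l : ℚ) else 0) +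
  (if v = Finsupp.single 3 1 then -((l : ℚ) / 2) else 0) +
  (if v = Finsupp.single 3 2 then 3 * (l : ℚ) / 4 else 0) +
  (if v = Finsupp.single 3 4 then θ else 0)

lemma twoDvd_tauDiff_sub_specialCoeff {N k m x : ℕ} (hN : 3 ≤ N) (hk : Odd k)
    (hm : 2 * N + 1 ≤ m) (hmmod : m % 4 = 2) {θ : ℚ}
    (hθ : θ = if N = 3 then -((k * 2 ^ N : ℕ) : ℚ) / 2 else ((k * 2 ^ N : ℕ) : ℚ) / 2)
    {v : ℕ →₀ ℕ} (hv0 : v 0 = 0) (hv : v 1 = 0) (hx : x + wt v = m + k * 2 ^ N) :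
    TwoDvd (N + 1) (tauDiff (k * 2 ^ N) x v -
      specialCoeff (k * 2 ^ N) m (m + k * 2 ^ N) θ v) := by
  have hm10 : 10 ≤ m := by omega
  by_cases hex : IsExceptional v
  · rcases hex with rfl | ⟨b, hb, rfl⟩ | ⟨b, rfl | rfl, rfl⟩
    · rw [wt_single] at hx
      simpa [specialCoeff, Finsupp.single_eq_single_iff,
        (single_two_add_single_three_ne_single_seven _ _).symm] using
        twoDvd_tauDiff_single_seven hN hmmod hm10 hx
    · rw [wt_single] at hx
      simp only [specialCoeff, Finsupp.single_eq_single_iff,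
        (single_two_add_single_three_ne_single_three _ _).symm]
      simp only [List.mem_cons, List.not_mem_nil, or_false] at hb
      rcases hb with rfl | rfl | rfl | rfl | rfl | rfl | rfl | rfl
      · obtain rfl : x = m + k * 2 ^ N := hx
        simpa using twoDvd_tauDiff_zero hN hmmod rfl
      · simpa using twoDvd_tauDiff_single_three_one hN hmmod hx
      · simpa using twoDvd_tauDiff_single_three_two hN hmmod hm10 hx
      · simpa using twoDvd_tauDiff_single_three_three hN hmmod hm10 hx
      · simpa using twoDvd_tauDiff_single_three_four hN hk hmmod hm10 hx hθ
      · simpa using twoDvd_tauDiff_single_three_five hN hk hmmod hm10 hx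
      · simpa using twoDvd_tauDiff_single_three_six hN hk hmmod hm10 hx
      · simpa using twoDvd_tauDiff_single_three_eight hN hk hmmod hm10 hx
    · rw [wt_single_add_single] at hx
      simpa [specialCoeff, single_two_add_single_three_ne_single_three,
        Finsupp.single_eq_single_iff] using twoDvd_tauDiff_two_three hN hmmod hm10 hx
    · rw [wt_single_add_single] at hx
      simpa [specialCoeff, single_two_add_single_three_ne_single_three,
        Finsupp.single_eq_single_iff] using twoDvd_tauDiff_two_three_three hN hmmod hm10 hx
  · have h3 : ∀ b ∈ [0, 1, 2, 3, 4, 5, 6, 8], v ≠ Finsupp.single 3 b := fun b hb h =>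
      hex (.inr (.inl ⟨b, hb, h⟩))
    have h23 : ∀ b, (b = 1 ∨ b = 2) → v ≠ Finsupp.single 2 1 + Finsupp.single 3 b :=
      fun b hb h => hex (.inr (.inr ⟨b, hb, h⟩))
    rw [specialCoeff, if_neg (h3 0 (by simp)), if_neg (h3 3 (by simp)), if_neg (h3 6 (by simp)),
      if_neg (h23 1 (by simp)), if_neg (h23 2 (by simp)), if_neg (h3 1 (by simp)),
      if_neg (h3 2 (by simp)), if_neg (h3 4 (by simp))]
    simpa using twoDvd_tauDiff_of_not_isExceptional hN hm hmmod hm10 hv0 hv hex hx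

end

/-- universal Kummer congruence mod 2^{N+1}, case m ≡ 2 (mod 4):
l = k·2^N (k odd), m ≥ 2N+1, n = m + l ≥ 18, θ = −l/2 if N = 3 and θ = l/2 if N ≥ 4. -/
theorem stmt_18 (N k : ℕ) (hN : 3 ≤ N) (hk : 1 ≤ k) (hkodd : Odd k)
    (l m n : ℕ) (hl : l = k * 2 ^ N) (hm : 2 * N + 1 ≤ m) (hmmod : m % 4 = 2)
    (hn : n = m + l) (hn18 : 18 ≤ n)
    (θ : ℚ) (hθ : θ = if N = 3 then -(l : ℚ) / 2 else (l : ℚ) / 2) :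
    PCong 2 (N + 1) (divB n)
      (X 1 ^ l * divB m
        + C ((l : ℚ) + (l : ℚ) / (2 * (m : ℚ) * (n : ℚ))) * X 1 ^ n
        + C (l : ℚ) * (X 1 ^ (n - 9) * X 3 ^ 3 + X 1 ^ (n - 18) * X 3 ^ 6
            + X 1 ^ (n - 5) * X 2 * X 3 + X 1 ^ (n - 8) * X 2 * X 3 ^ 2)
        - C ((l : ℚ) / 2) * X 1 ^ (n - 3) * X 3
        + C (3 * (l : ℚ) / 4) * X 1 ^ (n - 6) * X 3 ^ 2
        + C θ * X 1 ^ (n - 12) * X 3 ^ 4) := by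
  subst hn hl
  intro u
  refine TwoDvd.le_pval ?_
  set n := m + k * 2 ^ N with hn
  have hG : (X 1 ^ (k * 2 ^ N) * divB m
      + C (((k * 2 ^ N : ℕ) : ℚ) + ((k * 2 ^ N : ℕ) : ℚ) / (2 * (m : ℚ) * (n : ℚ))) * X 1 ^ n
      + C ((k * 2 ^ N : ℕ) : ℚ) * (X 1 ^ (n - 9) * X 3 ^ 3 + X 1 ^ (n - 18) * X 3 ^ 6
          + X 1 ^ (n - 5) * X 2 * X 3 + X 1 ^ (n - 8) * X 2 * X 3 ^ 2)
      - C (((k * 2 ^ N : ℕ) : ℚ) / 2) * X 1 ^ (n - 3) * X 3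
      + C (3 * ((k * 2 ^ N : ℕ) : ℚ) / 4) * X 1 ^ (n - 6) * X 3 ^ 2
      + C θ * X 1 ^ (n - 12) * X 3 ^ 4 : MvPolynomial ℕ ℚ) =
      X 1 ^ (k * 2 ^ N) * divB m
      + C (((k * 2 ^ N : ℕ) : ℚ) + ((k * 2 ^ N : ℕ) : ℚ) / (2 * (m : ℚ) * (n : ℚ))) * X 1 ^ n
        * X 3 ^ 0
      + C ((k * 2 ^ N : ℕ) : ℚ) * X 1 ^ (n - 9) * X 3 ^ 3
      + C ((k * 2 ^ N : ℕ) : ℚ) * X 1 ^ (n - 18) * X 3 ^ 6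
      + C ((k * 2 ^ N : ℕ) : ℚ) * X 1 ^ (n - 5) * X 2 * X 3 ^ 1
      + C ((k * 2 ^ N : ℕ) : ℚ) * X 1 ^ (n - 8) * X 2 * X 3 ^ 2
      + C (-(((k * 2 ^ N : ℕ) : ℚ) / 2)) * X 1 ^ (n - 3) * X 3 ^ 1
      + C (3 * ((k * 2 ^ N : ℕ) : ℚ) / 4) * X 1 ^ (n - 6) * X 3 ^ 2
      + C θ * X 1 ^ (n - 12) * X 3 ^ 4 := by
    rw [C_neg]
    ring
  rw [hG]
  simp only [C_mul_X_pow_mul_X_pow, C_mul_X_pow_mul_X_mul_X_pow, coeff_sub, coeff_add]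
  have h3 : ∀ b ≤ 6, ∀ a, a = n - 3 * b → ∀ c : ℚ,
      coeff u (monomial (Finsupp.single 1 a + Finsupp.single 3 b) c) =
        if (u 0 = 0 ∧ wt u = n) ∧ Finsupp.erase 1 u = Finsupp.single 3 b then c else 0 :=
    fun b hb a ha => coeff_monomial_single_one_add (by simp) (by simp)
      (by rw [wt_single]; omega)
  have h23 : ∀ b ≤ 2, ∀ a, a = n - (2 + 3 * b) → ∀ c : ℚ,
      coeff u (monomial (Finsupp.single 1 a + (Finsupp.single 2 1 + Finsupp.single 3 b)) c) =
        if (u 0 = 0 ∧ wt u = n) ∧ Finsupp.erase 1 u = Finsupp.single 2 1 + Finsupp.single 3 b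
          then c else 0 :=
    fun b hb a ha => coeff_monomial_single_one_add (by simp) (by simp)
      (by rw [wt_single_add_single]; omega)
  rw [h3 0 (by norm_num) n (by omega), h3 3 (by norm_num) (n - 9) rfl, h3 6 le_rfl (n - 18) rfl,
    h23 1 (by norm_num) (n - 5) rfl, h23 2 le_rfl (n - 8) rfl, h3 1 (by norm_num) (n - 3) rfl,
    h3 2 (by norm_num) (n - 6) rfl, h3 4 (by norm_num) (n - 12) rfl]
  by_cases hu : u 0 = 0 ∧ wt u = n
  · have h1 := wt_single_add (v := Finsupp.erase 1 u) (u 1)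
    rw [single_add_erase_one, hu.2] at h1
    have h2 := twoDvd_tauDiff_sub_specialCoeff (x := u 1) (v := Finsupp.erase 1 u) hN hkodd hm
      hmmod hθ (by simpa using hu.1) (by simp) h1.symm
    rw [← coeff_divB_sub m _ hu.1 hu.2, ← hn] at h2
    simp only [hu, true_and, and_self]
    convert h2 using 1
    rw [specialCoeff]
    ring
  · rw [coeff_X_one_pow_mul_divB m _ hu, coeff_divB, if_neg hu]
    simpa [hu] using TwoDvd.zero (N + 1)

end
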